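/- arXiv:cs/0204045 — 3 statements merged into one kernel-verified Lean document; each statement's English description precedes it below -/
import Mathlib

section
/- Let G₁, G₂, H₁, H₂, K₁, K₂ be basic feasible functionals, and assume the functionals F₁(u,α⃗) and F₂(u,α⃗) satisfy the simultaneous (multiple) limited recursion on notation: F₁(0,α⃗) = G₁(α⃗), F₂(0,α⃗) = G₂(α⃗), F₁(u,α⃗) = H₁(u, F₁(⌊u/2⌋,α⃗), F₂(⌊u/2⌋,α⃗), α⃗) and F₂(u,α⃗) = H₂(u, F₁(⌊u/2⌋,α⃗), F₂(⌊u/2⌋,α⃗), α⃗) for all u > 0, together with the bounds F₁(u,α⃗) ≤ K₁(u,α⃗) and F₂(u,α⃗) ≤ K₂(u,α⃗,F₁(u,α⃗)) for all u and α⃗. Then F₁ and F₂ are basic feasible functionals. -/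
/-- The smash function: `x # y = 2^(|x|·|y|)`, where `|x| = Nat.size x` is the binary length. -/
def smash (x y : ℕ) : ℕ := 2 ^ (Nat.size x * Nat.size y)

/-- The class BFF of basic feasible functionals.  A type 2 functional of rank `(k,l)` is
represented as a map `(Fin k → ℕ → ℕ) → (Fin l → ℕ) → ℕ`. -/
inductive BFF : (k l : ℕ) → ((Fin k → ℕ → ℕ) → (Fin l → ℕ) → ℕ) → Prop
  | zero : BFF 0 1 (fun _ _ => 0)
  | s0 : BFF 0 1 (fun _ x => 2 * x 0)
  | s1 : BFF 0 1 (fun _ x => 2 * x 0 + 1)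
  | proj (n : ℕ) (i : Fin n) : BFF 0 n (fun _ x => x i)
  | smashF : BFF 0 2 (fun _ x => smash (x 0) (x 1))
  | ap : BFF 1 1 (fun f x => f 0 (x 0))
  | expansion {k l k' l' : ℕ} (ρ : Fin k → Fin k') (σ : Fin l → Fin l')
      (hρ : Function.Injective ρ) (hσ : Function.Injective σ)
      {G : (Fin k → ℕ → ℕ) → (Fin l → ℕ) → ℕ} (hG : BFF k l G) :
      BFF k' l' (fun f x => G (fun i => f (ρ i)) (fun j => x (σ j)))
  | comp {k l m : ℕ} {H : (Fin k → ℕ → ℕ) → (Fin (m + l) → ℕ) → ℕ}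
      {G : Fin m → (Fin k → ℕ → ℕ) → (Fin l → ℕ) → ℕ}
      (hH : BFF k (m + l) H) (hG : ∀ i, BFF k l (G i)) :
      BFF k l (fun f x => H f (Fin.append (fun i => G i f x) x))
  | lrn {k l : ℕ} (F : (Fin k → ℕ → ℕ) → (Fin (l + 1) → ℕ) → ℕ)
      {G : (Fin k → ℕ → ℕ) → (Fin l → ℕ) → ℕ}
      {H₁ H₂ : (Fin k → ℕ → ℕ) → (Fin (l + 2) → ℕ) → ℕ}
      {K : (Fin k → ℕ → ℕ) → (Fin (l + 1) → ℕ) → ℕ}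
      (hG : BFF k l G) (hH₁ : BFF k (l + 2) H₁) (hH₂ : BFF k (l + 2) H₂)
      (hK : BFF k (l + 1) K)
      (hbase : ∀ f x, F f (Fin.snoc x 0) = G f x)
      (heven : ∀ f x y, 0 < y →
        F f (Fin.snoc x (2 * y)) = H₁ f (Fin.snoc (Fin.snoc x y) (F f (Fin.snoc x y))))
      (hodd : ∀ f x y,
        F f (Fin.snoc x (2 * y + 1)) = H₂ f (Fin.snoc (Fin.snoc x y) (F f (Fin.snoc x y))))
      (hbound : ∀ f x, Nat.size (F f x) ≤ Nat.size (K f x)) :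
      BFF k (l + 1) F

namespace BFFaux

/-- Recursion on notation. -/
def rn (g : ℕ) (h : ℕ → ℕ → ℕ) (u : ℕ) : ℕ :=
  if hu : u = 0 then g else h u (rn g h (u / 2))
termination_by u
decreasing_by omega

theorem rn_zero (g h) : rn g h 0 = g := by rw [rn]; simp

theorem rn_pos (g h) {u : ℕ} (hu : 0 < u) : rn g h u = h u (rn g h (u / 2)) := by
  rw [rn, dif_neg (by omega)]

/-- Induction on notation. -/
theorem ind {p : ℕ → Prop} (h0 : p 0) (hs : ∀ u, 0 < u → p (u / 2) → p u) (u : ℕ) : p u := by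
  induction u using Nat.strong_induction_on with
  | _ u ih =>
    rcases Nat.eq_zero_or_pos u with rfl | hu
    · exact h0
    · exact hs u hu (ih _ (by omega))

theorem size_half {u : ℕ} (hu : 0 < u) : Nat.size u = Nat.size (u / 2) + 1 := by
  have h1 : Nat.size u ≤ Nat.size (u / 2) + 1 := by
    rw [Nat.size_le, pow_succ]
    have := Nat.lt_size_self (u / 2)
    omega
  have h2 : Nat.size (u / 2) < Nat.size u := by
    obtain ⟨m, hm⟩ : ∃ m, Nat.size u = m + 1 :=
      ⟨Nat.size u - 1, by have := Nat.size_pos.2 hu; omega⟩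
    have := Nat.lt_size_self u
    rw [hm, pow_succ] at this
    have : Nat.size (u / 2) ≤ m := by rw [Nat.size_le]; omega
    omega
  omega

theorem size_smash_half (a b : ℕ) : Nat.size (smash a b / 2) = Nat.size a * Nat.size b := by
  have := size_half (u := smash a b) (by unfold smash; positivity)
  have h2 : Nat.size (smash a b) = Nat.size a * Nat.size b + 1 := by
    unfold smash; rw [Nat.size_pow]
  omega

theorem size_smash (a b : ℕ) : Nat.size (smash a b) = Nat.size a * Nat.size b + 1 := by
  unfold smash; rw [Nat.size_pow]

theorem size_odd (a : ℕ) : Nat.size (2 * a + 1) = Nat.size a + 1 := by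
  rw [size_half (by omega)]; congr 2; omega

abbrev Fl (k l : ℕ) := (Fin k → ℕ → ℕ) → (Fin l → ℕ) → ℕ

variable {k n : ℕ}

/-- vectors of functionals -/
def VB (k n m : ℕ) (V : (Fin k → ℕ → ℕ) → (Fin n → ℕ) → Fin m → ℕ) : Prop :=
  ∀ i, BFF k n (fun f x => V f x i)

theorem bcomp {m : ℕ} {H : Fl k m} (hH : BFF k m H)
    {V : (Fin k → ℕ → ℕ) → (Fin n → ℕ) → Fin m → ℕ} (hV : VB k n m V) :
    BFF k n (fun f x => H f (V f x)) := by
  have h1 : BFF k (m + n) (fun f z => H (fun i => f (id i)) (fun j => z (Fin.castAdd n j))) :=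
    BFF.expansion id (Fin.castAdd n) Function.injective_id (Fin.castAdd_injective m n) hH
  have h2 := BFF.comp h1 hV
  simpa using h2

theorem bcomp0 {m : ℕ} {H : Fl 0 m} (hH : BFF 0 m H)
    {V : (Fin k → ℕ → ℕ) → (Fin n → ℕ) → Fin m → ℕ} (hV : VB k n m V) :
    BFF k n (fun f x => H Fin.elim0 (V f x)) := by
  have h1 : BFF k m (fun f z => H (fun i => f (Fin.elim0 i)) (fun j => z (id j))) :=
    BFF.expansion Fin.elim0 id (fun i => i.elim0) Function.injective_id hH
  have h2 := bcomp h1 hV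
  have e : ∀ f : Fin k → ℕ → ℕ, (fun i : Fin 0 => f (Fin.elim0 i)) = Fin.elim0 :=
    fun f => funext fun i => i.elim0
  simpa [e] using h2

theorem bproj (i : Fin n) : BFF k n (fun _ x => x i) :=
  bcomp0 (H := fun _ x => x 0) (V := fun _ x _ => x i) (BFF.proj 1 0) (by
    intro _
    exact BFF.expansion Fin.elim0 id (fun i => i.elim0) Function.injective_id (BFF.proj n i))

theorem VB.cons {m : ℕ} {A : Fl k n} {V : (Fin k → ℕ → ℕ) → (Fin n → ℕ) → Fin m → ℕ}
    (hA : BFF k n A) (hV : VB k n m V) :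
    VB k n (m + 1) (fun f x => Fin.cons (A f x) (V f x)) := by
  intro i
  refine Fin.cases ?_ (fun j => ?_) i
  · simpa using hA
  · simpa using hV j

theorem VB.snoc {m : ℕ} {A : Fl k n} {V : (Fin k → ℕ → ℕ) → (Fin n → ℕ) → Fin m → ℕ}
    (hV : VB k n m V) (hA : BFF k n A) :
    VB k n (m + 1) (fun f x => Fin.snoc (V f x) (A f x)) := by
  intro i
  refine Fin.lastCases ?_ (fun j => ?_) i
  · simpa using hA
  · simpa using hV j

theorem VB.nil : VB k n 0 (fun _ _ => ![]) := fun i => i.elim0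

theorem VB.vcons {m : ℕ} {A : Fl k n} {V : (Fin k → ℕ → ℕ) → (Fin n → ℕ) → Fin m → ℕ}
    (hA : BFF k n A) (hV : VB k n m V) :
    VB k n (m + 1) (fun f x => Matrix.vecCons (A f x) (V f x)) := VB.cons hA hV

theorem VB.proj {m : ℕ} (σ : Fin m → Fin n) : VB k n m (fun _ x i => x (σ i)) :=
  fun i => bproj (σ i)

theorem b_zero' {A : Fl k n} (hA : BFF k n A) : BFF k n (fun _ _ => 0) :=
  bcomp0 (V := fun f x => ![A f x]) BFF.zero (VB.vcons hA VB.nil)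

theorem b_zero : BFF k (n + 1) (fun _ _ => 0) := b_zero' (bproj 0)

theorem b_s0 {A : Fl k n} (hA : BFF k n A) : BFF k n (fun f x => 2 * A f x) :=
  bcomp0 (V := fun f x => ![A f x]) BFF.s0 (VB.vcons hA VB.nil)

theorem b_s1 {A : Fl k n} (hA : BFF k n A) : BFF k n (fun f x => 2 * A f x + 1) :=
  bcomp0 (V := fun f x => ![A f x]) BFF.s1 (VB.vcons hA VB.nil)

theorem b_smash {A B : Fl k n} (hA : BFF k n A) (hB : BFF k n B) :
    BFF k n (fun f x => smash (A f x) (B f x)) :=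
  bcomp0 (V := fun f x => ![A f x, B f x]) BFF.smashF (VB.vcons hA (VB.vcons hB VB.nil))

theorem b_half {A : Fl k n} (hA : BFF k n A) : BFF k n (fun f x => A f x / 2) := by
  have h : BFF 0 2 (fun _ x => x 1 / 2) := by
    refine BFF.lrn (l := 1) _ (G := fun _ _ => 0) (H₁ := fun _ z => z 1) (H₂ := fun _ z => z 1)
      (K := fun _ z => z 1) b_zero (bproj 1) (bproj 1) (bproj 1) ?_ ?_ ?_ ?_
    · intro f x; simp [Fin.snoc]
    · intro f x y hy; simp [Fin.snoc]
    · intro f x y; simp [Fin.snoc]; omega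
    · intro f x; exact Nat.size_le_size (Nat.div_le_self _ _)
  exact bcomp0 (V := fun f x => ![A f x, A f x]) h (VB.vcons hA (VB.vcons hA VB.nil))

theorem b_mod2 {A : Fl k n} (hA : BFF k n A) : BFF k n (fun f x => A f x % 2) := by
  have h : BFF 0 2 (fun _ x => x 1 % 2) := by
    refine BFF.lrn (l := 1) _ (G := fun _ _ => 0) (H₁ := fun _ z => 0) (H₂ := fun _ z => 2 * 0 + 1)
      (K := fun _ z => z 1) b_zero b_zero (b_s1 b_zero) (bproj 1) ?_ ?_ ?_ ?_
    · intro f x; simp [Fin.snoc]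
    · intro f x y hy; simp [Fin.snoc]
    · intro f x y; simp [Fin.snoc]
    · intro f x; exact Nat.size_le_size (Nat.mod_le _ _)
  exact bcomp0 (V := fun f x => ![A f x, A f x]) h (VB.vcons hA (VB.vcons hA VB.nil))

/-- Limited recursion on notation, convenient form. -/
theorem b_rn {l : ℕ} {G : Fl k l}
    {H : (Fin k → ℕ → ℕ) → (Fin l → ℕ) → ℕ → ℕ → ℕ}
    {K : (Fin k → ℕ → ℕ) → (Fin l → ℕ) → ℕ → ℕ}
    (hG : BFF k l G)
    (hH : BFF k (l + 2) (fun f z => H f (fun i => z i.castSucc.castSucc)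
      (z (Fin.last l).castSucc) (z (Fin.last _))))
    (hK : BFF k (l + 1) (fun f z => K f (fun i => z i.castSucc) (z (Fin.last l))))
    (hb : ∀ f x u, Nat.size (rn (G f x) (H f x) u) ≤ Nat.size (K f x u))
    {V : (Fin k → ℕ → ℕ) → (Fin n → ℕ) → Fin l → ℕ} (hV : VB k n l V)
    {U : Fl k n} (hU : BFF k n U) :
    BFF k n (fun f x => rn (G f (V f x)) (H f (V f x)) (U f x)) := by
  have h : BFF k (l + 1) (fun f z => rn (G f (fun i => z i.castSucc))
      (H f (fun i => z i.castSucc)) (z (Fin.last l))) := by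
    have hp : VB k (l + 2) l (fun _ z i => z i.castSucc.castSucc) := VB.proj _
    have hH₁ := bcomp hH (VB.snoc (VB.snoc hp (b_s0 (bproj (Fin.last l).castSucc)))
      (bproj (Fin.last (l + 1))))
    have hH₂ := bcomp hH (VB.snoc (VB.snoc hp (b_s1 (bproj (Fin.last l).castSucc)))
      (bproj (Fin.last (l + 1))))
    refine BFF.lrn _ hG hH₁ hH₂ hK ?_ ?_ ?_ ?_
    · intro f x; simp [rn_zero]
    · intro f x y hy; simp; rw [rn_pos _ _ (by omega)]; simp
    · intro f x y; simp; rw [rn_pos _ _ (by omega)]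
      rw [show (2 * y + 1) / 2 = y by omega]
    · intro f x; exact hb _ _ _
  have := bcomp h (VB.snoc hV hU)
  simpa using this

theorem b_cond {C A B : Fl k n} (hC : BFF k n C) (hA : BFF k n A) (hB : BFF k n B) :
    BFF k n (fun f x => if C f x = 0 then A f x else B f x) := by
  have := b_rn (k := k) (l := 2) (G := fun _ z => z 0) (H := fun _ z _ _ => z 1)
    (K := fun _ z _ => smash (2 * z 0 + 1) (2 * z 1 + 1)) (bproj 0) (bproj _)
    (b_smash (b_s1 (bproj _)) (b_s1 (bproj _))) (by
      intro f x u
      rw [size_smash, size_odd, size_odd]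
      rcases Nat.eq_zero_or_pos u with rfl | hu
      · rw [rn_zero]; nlinarith [Nat.zero_le (x 0).size, Nat.zero_le (x 1).size]
      · rw [rn_pos _ _ hu]; nlinarith [Nat.zero_le (x 0).size, Nat.zero_le (x 1).size])
    (V := fun f x => ![A f x, B f x]) (VB.vcons hA (VB.vcons hB VB.nil)) hC
  convert this using 3 with f x
  split_ifs with h
  · rw [h, rn_zero]; rfl
  · rw [rn_pos _ _ (by omega)]; rfl

theorem rn_shift (a u : ℕ) : rn a (fun _ r => r / 2) u = a / 2 ^ Nat.size u := by
  induction u using ind with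
  | h0 => simp [rn_zero]
  | hs u hu ih => rw [rn_pos _ _ hu, ih, size_half hu, pow_succ, Nat.div_div_eq_div_mul]

theorem b_shift {A B : Fl k n} (hA : BFF k n A) (hB : BFF k n B) :
    BFF k n (fun f x => A f x / 2 ^ Nat.size (B f x)) := by
  have := b_rn (k := k) (l := 1) (G := fun _ z => z 0) (H := fun _ z _ r => r / 2)
    (K := fun _ z _ => z 0) (bproj 0) (b_half (bproj _)) (bproj _) (by
      intro f x u
      rw [rn_shift]
      exact Nat.size_le_size (Nat.div_le_self _ _))
    (V := fun f x => ![A f x]) (VB.vcons hA VB.nil) hB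
  simpa [rn_shift] using this

def catStep (X y u r : ℕ) : ℕ :=
  if (X / 2 ^ Nat.size (y / 2 ^ Nat.size u)) % 2 = 0 then 2 * r else 2 * r + 1

theorem size_div_pow (y m : ℕ) : Nat.size (y / 2 ^ m) = Nat.size y - m := by
  induction m with
  | zero => simp
  | succ m ih =>
    rw [pow_succ, ← Nat.div_div_eq_div_mul]
    rcases Nat.eq_zero_or_pos (y / 2 ^ m) with h | h
    · rw [h] at ih ⊢; simp at ih ⊢; omega
    · have := size_half h; omega

theorem rn_cat (a X y u : ℕ) (h : Nat.size u ≤ Nat.size y) : rn a (catStep X y) u =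
    a * 2 ^ Nat.size u + (X / 2 ^ (Nat.size y - Nat.size u)) % 2 ^ Nat.size u := by
  induction u using ind with
  | h0 => simp [rn_zero, Nat.mod_one]
  | hs u hu ih =>
    have hs := size_half hu
    rw [rn_pos _ _ hu, ih (by omega), catStep, size_div_pow]
    obtain ⟨d, hd⟩ : ∃ d, Nat.size y = Nat.size u + d := ⟨_, (Nat.add_sub_cancel' h).symm⟩
    rw [hd, hs]
    generalize Nat.size (u / 2) = m
    rw [show m + 1 + d - m = d + 1 by omega, show m + 1 + d - (m + 1) = d by omega, pow_succ 2 d,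
      ← Nat.div_div_eq_div_mul]
    generalize X / 2 ^ d = Z
    have : Z % 2 ^ (m + 1) = Z % 2 + 2 * (Z / 2 % 2 ^ m) := by
      rw [pow_succ', Nat.mod_mul]
    rw [this, pow_succ]
    generalize Z / 2 % 2 ^ m = t
    split_ifs with h
    · rw [h]; ring
    · rw [show Z % 2 = 1 by omega]; ring

theorem rn_cat_size (a X y u : ℕ) :
    Nat.size (rn a (catStep X y) u) ≤ Nat.size a + Nat.size u := by
  induction u using ind with
  | h0 => simp [rn_zero]
  | hs u hu ih =>
    rw [rn_pos _ _ hu, size_half hu, ← add_assoc]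
    rw [Nat.size_le, pow_succ]
    rw [Nat.size_le] at ih
    generalize rn a (catStep X y) (u / 2) = t at ih
    unfold catStep
    split_ifs <;> omega

theorem b_cat {A X Y : Fl k n} (hA : BFF k n A) (hX : BFF k n X) (hY : BFF k n Y) :
    BFF k n (fun f x => A f x * 2 ^ Nat.size (Y f x) + X f x % 2 ^ Nat.size (Y f x)) := by
  have := b_rn (k := k) (l := 3) (G := fun _ z => z 0) (H := fun _ z u r => catStep (z 1) (z 2) u r)
    (K := fun _ z u => smash (2 * z 0 + 1) (2 * u + 1)) (bproj 0)
    (b_cond (b_mod2 (b_shift (bproj _) (b_shift (bproj _) (bproj _))))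
      (b_s0 (bproj _)) (b_s1 (bproj _)))
    (b_smash (b_s1 (bproj _)) (b_s1 (bproj _))) (by
      intro f x u
      refine (rn_cat_size _ _ _ _).trans ?_
      rw [size_smash, size_odd, size_odd]
      nlinarith [Nat.zero_le (x 0).size, Nat.zero_le u.size])
    (V := fun f x => ![A f x, X f x, Y f x]) (VB.vcons hA (VB.vcons hX (VB.vcons hY VB.nil))) hY
  convert this using 3 with f x
  have := rn_cat (A f x) (X f x) (Y f x) (Y f x) le_rfl
  simp at this
  exact this.symm

theorem b_low {A B : Fl k n} (hA : BFF k n A) (hB : BFF k n B) :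
    BFF k n (fun f x => A f x % 2 ^ Nat.size (B f x)) := by
  simpa using b_cat (b_zero' hA) hA hB

/-- extraction of the block with index `|v|` -/
def item (S w v : ℕ) : ℕ := S / 2 ^ (Nat.size w * Nat.size v) % 2 ^ Nat.size w

theorem b_item {S W V : Fl k n} (hS : BFF k n S) (hW : BFF k n W) (hV : BFF k n V) :
    BFF k n (fun f x => item (S f x) (W f x) (V f x)) := by
  have := b_low (b_shift hS (b_half (b_smash hW hV))) hW
  simpa [size_smash_half, item] using this

/-- adding a block on top -/
def push (a S w v : ℕ) : ℕ :=
  (a % 2 ^ Nat.size w) * 2 ^ (Nat.size w * Nat.size v) + S % 2 ^ (Nat.size w * Nat.size v)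

theorem b_push {A S W V : Fl k n} (hA : BFF k n A) (hS : BFF k n S) (hW : BFF k n W)
    (hV : BFF k n V) :
    BFF k n (fun f x => push (A f x) (S f x) (W f x) (V f x)) := by
  have := b_cat (b_low hA hW) hS (b_half (b_smash hW hV))
  simpa [size_smash_half, push] using this

theorem size_push (a S w v : ℕ) : Nat.size (push a S w v) ≤ Nat.size w * (Nat.size v + 1) := by
  rw [Nat.size_le, push, mul_add, mul_one, pow_add]
  have h1 := Nat.mod_lt a (show 0 < 2 ^ Nat.size w by positivity)
  have h2 := Nat.mod_lt S (show 0 < 2 ^ (Nat.size w * Nat.size v) by positivity)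
  have h3 := Nat.mul_le_mul_right (2 ^ (Nat.size w * Nat.size v)) (Nat.succ_le_of_lt h1)
  rw [Nat.succ_mul] at h3
  rw [Nat.mul_comm (2 ^ (Nat.size w * Nat.size v))]
  omega

theorem item_push_self (a S w v : ℕ) : item (push a S w v) w v = a % 2 ^ Nat.size w := by
  have h2 := Nat.mod_lt S (show 0 < 2 ^ (Nat.size w * Nat.size v) by positivity)
  rw [item, push, Nat.mul_comm (a % _), Nat.mul_add_div (by positivity), Nat.div_eq_of_lt h2]
  simp

theorem item_push_of_lt (a S w v v' : ℕ) (h : Nat.size v' < Nat.size v) :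
    item (push a S w v) w v' = item S w v' := by
  have h2 := Nat.mod_lt S (show 0 < 2 ^ (Nat.size w * Nat.size v) by positivity)
  have h3 : Nat.size w * (Nat.size v' + 1) ≤ Nat.size w * Nat.size v := Nat.mul_le_mul_left _ h
  rw [mul_add, mul_one] at h3
  apply Nat.eq_of_testBit_eq
  intro i
  rw [item, item, push, Nat.mul_comm (a % _)]
  rw [Nat.testBit_mod_two_pow, Nat.testBit_mod_two_pow, Nat.testBit_div_two_pow,
    Nat.testBit_div_two_pow, Nat.testBit_two_pow_mul_add _ h2]
  by_cases hi : i < Nat.size w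
  · rw [if_pos (by omega), Nat.testBit_mod_two_pow]
    simp [show i + Nat.size w * Nat.size v' < Nat.size w * Nat.size v by omega]
  · simp [hi]

theorem mod_eq_of_size {a b : ℕ} {m : ℕ} (h : a ≤ b) (hm : Nat.size b ≤ m) : a % 2 ^ m = a :=
  Nat.mod_eq_of_lt (Nat.size_le.1 ((Nat.size_le_size h).trans hm))

end BFFaux

open BFFaux in
/-- Multiple (simultaneous) limited recursion on notation for two functionals:
if `F₁, F₂` satisfy `F₁(0,α⃗) = G₁(α⃗)`, `F₂(0,α⃗) = G₂(α⃗)`,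
`Fᵢ(u,α⃗) = Hᵢ(u, F₁(⌊u/2⌋,α⃗), F₂(⌊u/2⌋,α⃗), α⃗)` for `u > 0`, together with the bounds
`F₁(u,α⃗) ≤ K₁(u,α⃗)` and `F₂(u,α⃗) ≤ K₂(u,α⃗,F₁(u,α⃗))`, where all of
`G₁, G₂, H₁, H₂, K₁, K₂` are basic feasible, then `F₁` and `F₂` are basic feasible. -/
theorem bff_multiple_limited_recursion_on_notation (k l : ℕ)
    (G₁ G₂ : (Fin k → ℕ → ℕ) → (Fin l → ℕ) → ℕ)
    (H₁ H₂ : (Fin k → ℕ → ℕ) → (Fin (l + 3) → ℕ) → ℕ)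
    (K₁ : (Fin k → ℕ → ℕ) → (Fin (l + 1) → ℕ) → ℕ)
    (K₂ : (Fin k → ℕ → ℕ) → (Fin (l + 2) → ℕ) → ℕ)
    (F₁ F₂ : (Fin k → ℕ → ℕ) → (Fin (l + 1) → ℕ) → ℕ)
    (hG₁ : BFF k l G₁) (hG₂ : BFF k l G₂)
    (hH₁ : BFF k (l + 3) H₁) (hH₂ : BFF k (l + 3) H₂)
    (hK₁ : BFF k (l + 1) K₁) (hK₂ : BFF k (l + 2) K₂)
    (hbase₁ : ∀ f x, F₁ f (Fin.cons 0 x) = G₁ f x)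
    (hbase₂ : ∀ f x, F₂ f (Fin.cons 0 x) = G₂ f x)
    (hrec₁ : ∀ f x u, 0 < u → F₁ f (Fin.cons u x) =
      H₁ f (Fin.cons u (Fin.cons (F₁ f (Fin.cons (u / 2) x))
        (Fin.cons (F₂ f (Fin.cons (u / 2) x)) x))))
    (hrec₂ : ∀ f x u, 0 < u → F₂ f (Fin.cons u x) =
      H₂ f (Fin.cons u (Fin.cons (F₁ f (Fin.cons (u / 2) x))
        (Fin.cons (F₂ f (Fin.cons (u / 2) x)) x))))
    (hbd₁ : ∀ f x u, F₁ f (Fin.cons u x) ≤ K₁ f (Fin.cons u x))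
    (hbd₂ : ∀ f x u, F₂ f (Fin.cons u x) ≤
      K₂ f (Fin.cons u (Fin.snoc x (F₁ f (Fin.cons u x))))) :
    BFF k (l + 1) F₁ ∧ BFF k (l + 1) F₂ := by
  -- the prefix of `u` maximising the length of `K₁`
  let P : (Fin k → ℕ → ℕ) → (Fin l → ℕ) → ℕ → ℕ := fun f x => rn 0 (fun u r =>
    if K₁ f (Fin.cons u x) / 2 ^ Nat.size (K₁ f (Fin.cons r x)) = 0 then r else u)
  have hPle : ∀ f x u, P f x u ≤ u := by
    intro f x u
    induction u using ind with
    | h0 => simp [P, rn_zero]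
    | hs u hu ih =>
      simp only [P] at ih ⊢
      rw [rn_pos _ _ hu]
      split_ifs <;> omega
  have hPmax : ∀ f x u j, Nat.size (K₁ f (Fin.cons (u / 2 ^ j) x)) ≤
      Nat.size (K₁ f (Fin.cons (P f x u) x)) := by
    intro f x u
    induction u using ind with
    | h0 => intro j; simp [P, rn_zero]
    | hs u hu ih =>
      have key : P f x u = if K₁ f (Fin.cons u x) / 2 ^ Nat.size (K₁ f (Fin.cons (P f x (u / 2)) x))
          = 0 then P f x (u / 2) else u := rn_pos _ _ hu
      intro j
      cases j with
      | zero =>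
        rw [key]
        split_ifs with h
        · rw [Nat.div_eq_zero_iff] at h
          rw [Nat.size_le]
          have : 0 < 2 ^ Nat.size (K₁ f (Fin.cons (P f x (u / 2)) x)) := by positivity
          simp only [pow_zero, Nat.div_one]
          omega
        · simp
      | succ j =>
        rw [pow_succ', ← Nat.div_div_eq_div_mul]
        refine (ih j).trans ?_
        rw [key]
        split_ifs with h
        · exact le_rfl
        · rw [Nat.div_eq_zero_iff, ← Nat.size_le] at h
          omega
  have bP : BFF k (l + 1) (fun f z => P f (fun i => z i.succ) (z 0)) := by
    refine b_rn (k := k) (l := l) (G := fun _ _ => 0) (H := fun f x u r =>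
      if K₁ f (Fin.cons u x) / 2 ^ Nat.size (K₁ f (Fin.cons r x)) = 0 then r else u)
      (K := fun _ _ u => u) (b_zero' hG₁) ?_ (bproj _) ?_
      (V := fun _ z i => z i.succ) (VB.proj _) (bproj 0)
    · exact b_cond (b_shift (bcomp hK₁ (VB.cons (bproj _) (VB.proj _)))
        (bcomp hK₁ (VB.cons (bproj _) (VB.proj _)))) (bproj _) (bproj _)
    · intro f x u
      exact Nat.size_le_size (hPle f x u)
  -- recomputation of `F₂` from a table `S` of values of `F₁`
  let T : (Fin k → ℕ → ℕ) → (Fin l → ℕ) → ℕ → ℕ → ℕ → ℕ := fun f x w S =>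
    rn (G₂ f x % 2 ^ Nat.size (K₂ f (Fin.cons 0 (Fin.snoc x (item S w 0)))))
      (fun u r => H₂ f (Fin.cons u (Fin.cons (item S w (u / 2)) (Fin.cons r x))) %
        2 ^ Nat.size (K₂ f (Fin.cons u (Fin.snoc x (item S w u)))))
  have hT : ∀ f x w S u, (∀ j, item S w (u / 2 ^ j) = F₁ f (Fin.cons (u / 2 ^ j) x)) →
      T f x w S u = F₂ f (Fin.cons u x) := by
    intro f x w S u
    induction u using ind with
    | h0 =>
      intro h
      have h0 := h 0
      simp only [pow_zero, Nat.div_one] at h0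
      simp only [T, rn_zero]
      rw [h0, ← hbase₂, mod_eq_of_size (hbd₂ f x 0) le_rfl]
    | hs u hu ih =>
      intro h
      have h0 := h 0
      have h1 := h 1
      simp only [pow_zero, pow_one, Nat.div_one] at h0 h1
      have ih' := ih (fun j => by
        have := h (j + 1)
        rwa [pow_succ', ← Nat.div_div_eq_div_mul] at this)
      have key : T f x w S u =
        H₂ f (Fin.cons u (Fin.cons (item S w (u / 2)) (Fin.cons (T f x w S (u / 2)) x))) %
        2 ^ Nat.size (K₂ f (Fin.cons u (Fin.snoc x (item S w u)))) := rn_pos _ _ hu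
      rw [key, ih', h0, h1, ← hrec₂ f x u hu, mod_eq_of_size (hbd₂ f x u) le_rfl]
  have bT : ∀ {n : ℕ} {V : (Fin k → ℕ → ℕ) → (Fin n → ℕ) → Fin l → ℕ} {W S U : Fl k n},
      VB k n l V → BFF k n W → BFF k n S → BFF k n U →
      BFF k n (fun f x => T f (V f x) (W f x) (S f x) (U f x)) := by
    intro n V W S U hV hW hS hU
    have := b_rn (k := k) (l := l + 2)
      (G := fun f z => G₂ f (fun i => z i.castSucc.castSucc) %
        2 ^ Nat.size (K₂ f (Fin.cons 0 (Fin.snoc (fun i => z i.castSucc.castSucc)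
          (item (z (Fin.last _)) (z (Fin.last l).castSucc) 0)))))
      (H := fun f z u r => H₂ f (Fin.cons u (Fin.cons
          (item (z (Fin.last _)) (z (Fin.last l).castSucc) (u / 2))
          (Fin.cons r (fun i => z i.castSucc.castSucc)))) %
        2 ^ Nat.size (K₂ f (Fin.cons u (Fin.snoc (fun i => z i.castSucc.castSucc)
          (item (z (Fin.last _)) (z (Fin.last l).castSucc) u)))))
      (K := fun f z u => K₂ f (Fin.cons u (Fin.snoc (fun i => z i.castSucc.castSucc)
          (item (z (Fin.last _)) (z (Fin.last l).castSucc) u))))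
      (b_low (bcomp hG₂ (VB.proj _)) (bcomp hK₂ (VB.cons b_zero (VB.snoc (VB.proj _)
        (b_item (bproj _) (bproj _) b_zero)))))
      (b_low (bcomp hH₂ (VB.cons (bproj _) (VB.cons (b_item (bproj _) (bproj _)
          (b_half (bproj _))) (VB.cons (bproj _) (VB.proj _)))))
        (bcomp hK₂ (VB.cons (bproj _) (VB.snoc (VB.proj _)
        (b_item (bproj _) (bproj _) (bproj _))))))
      (bcomp hK₂ (VB.cons (bproj _) (VB.snoc (VB.proj _)
        (b_item (bproj _) (bproj _) (bproj _)))))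
      (by
        intro f z u
        rcases Nat.eq_zero_or_pos u with rfl | hu
        · rw [rn_zero, Nat.size_le]
          exact Nat.mod_lt _ (by positivity)
        · rw [rn_pos _ _ hu, Nat.size_le]
          exact Nat.mod_lt _ (by positivity))
      (V := fun f x => Fin.snoc (Fin.snoc (V f x) (W f x)) (S f x))
      (VB.snoc (VB.snoc hV hW) hS) hU
    simpa [T] using this
  -- the table of values of `F₁`, with blocks of length `|w|`
  let Q : (Fin k → ℕ → ℕ) → (Fin l → ℕ) → ℕ → ℕ → ℕ := fun f x w =>
    rn (G₁ f x % 2 ^ Nat.size w) (fun u r =>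
      push (H₁ f (Fin.cons u (Fin.cons (item r w (u / 2))
        (Fin.cons (T f x w r (u / 2)) x)))) r w u)
  have hQ : ∀ f x w u, (∀ j, Nat.size (K₁ f (Fin.cons (u / 2 ^ j) x)) ≤ Nat.size w) →
      ∀ j, item (Q f x w u) w (u / 2 ^ j) = F₁ f (Fin.cons (u / 2 ^ j) x) := by
    intro f x w u
    induction u using ind with
    | h0 =>
      intro h j
      have h0 := h 0
      simp only [Nat.zero_div] at h0
      simp only [Q, rn_zero, Nat.zero_div, item, Nat.size_zero, mul_zero, pow_zero, Nat.div_one,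
        Nat.mod_mod]
      rw [← hbase₁, mod_eq_of_size (hbd₁ f x 0) h0]
    | hs u hu ih =>
      intro h
      have ih' := ih (fun j => by
        have := h (j + 1)
        rwa [pow_succ', ← Nat.div_div_eq_div_mul] at this)
      have key : Q f x w u = push (H₁ f (Fin.cons u (Fin.cons (item (Q f x w (u / 2)) w (u / 2))
        (Fin.cons (T f x w (Q f x w (u / 2)) (u / 2)) x)))) (Q f x w (u / 2)) w u := rn_pos _ _ hu
      intro j
      cases j with
      | zero =>
        have h0 := h 0
        have h1 := ih' 0
        simp only [pow_zero, Nat.div_one] at h0 h1 ⊢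
        rw [key, item_push_self, hT f x w _ _ ih', h1, ← hrec₁ f x u hu,
          mod_eq_of_size (hbd₁ f x u) h0]
      | succ j =>
        rw [pow_succ', ← Nat.div_div_eq_div_mul, key, item_push_of_lt, ih' j]
        have := size_half hu
        have := Nat.size_le_size (Nat.div_le_self (u / 2) (2 ^ j))
        omega
  have bQ : ∀ {n : ℕ} {V : (Fin k → ℕ → ℕ) → (Fin n → ℕ) → Fin l → ℕ} {W U : Fl k n},
      VB k n l V → BFF k n W → BFF k n U →
      BFF k n (fun f x => Q f (V f x) (W f x) (U f x)) := by
    intro n V W U hV hW hU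
    have := b_rn (k := k) (l := l + 1)
      (G := fun f z => G₁ f (fun i => z i.castSucc) % 2 ^ Nat.size (z (Fin.last l)))
      (H := fun f z u r => push (H₁ f (Fin.cons u (Fin.cons (item r (z (Fin.last l)) (u / 2))
        (Fin.cons (T f (fun i => z i.castSucc) (z (Fin.last l)) r (u / 2))
          (fun i => z i.castSucc))))) r (z (Fin.last l)) u)
      (K := fun f z u => smash (z (Fin.last l)) (2 * u + 1))
      (b_low (bcomp hG₁ (VB.proj _)) (bproj _))
      (b_push (bcomp hH₁ (VB.cons (bproj _) (VB.cons (b_item (bproj _) (bproj _)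
          (b_half (bproj _))) (VB.cons
            (bT (VB.proj _) (bproj _) (bproj _) (b_half (bproj _))) (VB.proj _)))))
        (bproj _) (bproj _) (bproj _))
      (b_smash (bproj _) (b_s1 (bproj _)))
      (by
        intro f z u
        rw [size_smash, size_odd]
        rcases Nat.eq_zero_or_pos u with rfl | hu
        · rw [rn_zero]
          refine le_trans (Nat.size_le.2 (Nat.mod_lt _ (by positivity))) ?_
          simp
        · rw [rn_pos _ _ hu]
          exact (size_push _ _ _ _).trans (Nat.le_succ _))
      (V := fun f x => Fin.snoc (V f x) (W f x))
      (VB.snoc hV hW) hU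
    simpa [Q] using this
  -- assembling
  let w : Fl k (l + 1) := fun f z =>
    K₁ f (Fin.cons (P f (fun i => z i.succ) (z 0)) (fun i => z i.succ))
  have bw : BFF k (l + 1) w := bcomp hK₁ (VB.cons bP (VB.proj _))
  have bS : BFF k (l + 1) (fun f z => Q f (fun i => z i.succ) (w f z) (z 0)) :=
    bQ (VB.proj _) bw (bproj 0)
  have hS : ∀ f z j, item (Q f (fun i => z i.succ) (w f z) (z 0)) (w f z) (z 0 / 2 ^ j) =
      F₁ f (Fin.cons (z 0 / 2 ^ j) (fun i => z i.succ)) :=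
    fun f z => hQ f _ (w f z) (z 0) (hPmax f _ (z 0))
  have hz : ∀ z : Fin (l + 1) → ℕ, (Fin.cons (z 0) (fun i => z i.succ) : Fin (l + 1) → ℕ) = z :=
    fun z => Fin.cons_self_tail z
  constructor
  · have := b_item bS bw (bproj 0)
    convert this using 3 with f z
    have := hS f z 0
    simp only [pow_zero, Nat.div_one] at this
    rw [this, hz]
  · have := bT (VB.proj Fin.succ) bw bS (bproj 0)
    convert this using 3 with f z
    rw [hT f _ _ _ _ (hS f z), hz]
end

section
/- Let n ≥ 1 and let G₁,…,Gₙ, H₁,…,Hₙ, K₁,…,Kₙ be basic feasible functionals. Assume functionals F₁,…,Fₙ satisfy, for every i with 1 ≤ i ≤ n: Fᵢ(0,α⃗) = Gᵢ(α⃗); Fᵢ(u,α⃗) = Hᵢ(u, F₁(⌊u/2⌋,α⃗), …, Fₙ(⌊u/2⌋,α⃗), α⃗) for all u > 0; and Fᵢ(u,α⃗) ≤ Kᵢ(u, α⃗, F₁(u,α⃗), …, F_{i−1}(u,α⃗)) for all u and α⃗ (so the bound on Fᵢ may depend on the values of the earlier functionals F₁,…,F_{i−1}). Then each Fᵢ is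 a basic feasible functional. -/
namespace BFFAux

/-- Every basic feasible functional (as defined) has at least one number argument. -/
theorem pos {k l : ℕ} {F : (Fin k → ℕ → ℕ) → (Fin l → ℕ) → ℕ} (h : BFF k l F) : 0 < l := by
  induction h with
  | zero => omega
  | s0 => omega
  | s1 => omega
  | proj n i => exact i.pos
  | smashF => omega
  | ap => omega
  | expansion ρ σ hρ hσ hG ih => exact (σ ⟨0, ih⟩).pos
  | @comp k l m H G hH hG ihH ihG =>
    rcases Nat.eq_zero_or_pos m with h | h
    · omega
    · exact ihG ⟨0, h⟩
  | lrn => omega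

/-- Plain composition without the extra arguments. -/
theorem comp' {k l m : ℕ} {H : (Fin k → ℕ → ℕ) → (Fin m → ℕ) → ℕ}
    {G : Fin m → (Fin k → ℕ → ℕ) → (Fin l → ℕ) → ℕ}
    (hH : BFF k m H) (hG : ∀ i, BFF k l (G i)) :
    BFF k l (fun f x => H f (fun i => G i f x)) := by
  have h1 := BFF.expansion (k' := k) (l' := m + l) id (Fin.castAdd l) Function.injective_id
    (Fin.castAdd_injective m l) hH
  have h2 := BFF.comp h1 hG
  simpa using h2

theorem lift0 {k m : ℕ} {H : (Fin 0 → ℕ → ℕ) → (Fin m → ℕ) → ℕ} (hH : BFF 0 m H) :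
    BFF k m (fun _ x => H Fin.elim0 x) := by
  have h1 := BFF.expansion (k' := k) (l' := m) Fin.elim0 id (fun a => a.elim0)
    Function.injective_id hH
  have e : ∀ f : Fin k → ℕ → ℕ,
      (fun i : Fin 0 => f (Fin.elim0 i)) = (Fin.elim0 : Fin 0 → ℕ → ℕ) := by
    intro f
    funext a
    exact a.elim0
  simp only [e] at h1
  exact h1

theorem var {k l : ℕ} (i : Fin l) : BFF k l (fun _ x => x i) := lift0 (BFF.proj l i)

theorem const0 {k l : ℕ} (h : 0 < l) : BFF k l (fun _ _ => 0) :=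
  comp' (lift0 BFF.zero) (fun _ => var ⟨0, h⟩)

section
variable {k l : ℕ} {a b c d : (Fin k → ℕ → ℕ) → (Fin l → ℕ) → ℕ}

theorem dbl (ha : BFF k l a) : BFF k l (fun f x => 2 * a f x) :=
  comp' (lift0 BFF.s0) (fun _ => ha)

theorem dbl1 (ha : BFF k l a) : BFF k l (fun f x => 2 * a f x + 1) :=
  comp' (lift0 BFF.s1) (fun _ => ha)

theorem sm (ha : BFF k l a) (hb : BFF k l b) : BFF k l (fun f x => smash (a f x) (b f x)) := by
  have := comp' (G := ![a, b]) (lift0 (k := k) BFF.smashF)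
    (fun i => by fin_cases i <;> assumption)
  simpa using this

end

/-- Closure form of `Φ(u, p)` is basic feasible. -/
def B2 {k l : ℕ} (Φ : (Fin k → ℕ → ℕ) → ℕ → (Fin l → ℕ) → ℕ) : Prop :=
  ∀ (l' : ℕ) (u : (Fin k → ℕ → ℕ) → (Fin l' → ℕ) → ℕ)
    (p : Fin l → (Fin k → ℕ → ℕ) → (Fin l' → ℕ) → ℕ),
    BFF k l' u → (∀ j, BFF k l' (p j)) →
    BFF k l' (fun f z => Φ f (u f z) (fun j => p j f z))

/-- Closure form of `Φ(u, y, p)` is basic feasible, `y` a tuple. -/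
def B3 {k n l : ℕ} (Φ : (Fin k → ℕ → ℕ) → ℕ → (Fin n → ℕ) → (Fin l → ℕ) → ℕ) : Prop :=
  ∀ (l' : ℕ) (u : (Fin k → ℕ → ℕ) → (Fin l' → ℕ) → ℕ)
    (y : Fin n → (Fin k → ℕ → ℕ) → (Fin l' → ℕ) → ℕ)
    (p : Fin l → (Fin k → ℕ → ℕ) → (Fin l' → ℕ) → ℕ),
    BFF k l' u → (∀ j, BFF k l' (y j)) → (∀ j, BFF k l' (p j)) →
    BFF k l' (fun f z => Φ f (u f z) (fun j => y j f z) (fun j => p j f z))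

/-- Closure form of `Φ(y, r, p)` is basic feasible. -/
def B2' {k l : ℕ} (Φ : (Fin k → ℕ → ℕ) → ℕ → ℕ → (Fin l → ℕ) → ℕ) : Prop :=
  ∀ (l' : ℕ) (u r : (Fin k → ℕ → ℕ) → (Fin l' → ℕ) → ℕ)
    (p : Fin l → (Fin k → ℕ → ℕ) → (Fin l' → ℕ) → ℕ),
    BFF k l' u → BFF k l' r → (∀ j, BFF k l' (p j)) →
    BFF k l' (fun f z => Φ f (u f z) (r f z) (fun j => p j f z))

/-- Limited recursion on notation in closure form. -/
theorem lrn' {k l : ℕ} (F : (Fin k → ℕ → ℕ) → ℕ → (Fin l → ℕ) → ℕ)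
    (G : (Fin k → ℕ → ℕ) → (Fin l → ℕ) → ℕ)
    (H₁ H₂ : (Fin k → ℕ → ℕ) → ℕ → ℕ → (Fin l → ℕ) → ℕ)
    (K : (Fin k → ℕ → ℕ) → ℕ → (Fin l → ℕ) → ℕ)
    (hG : BFF k l G) (hH₁ : B2' H₁) (hH₂ : B2' H₂) (hK : B2 K)
    (hbase : ∀ f p, F f 0 p = G f p)
    (heven : ∀ f p y, 0 < y → F f (2 * y) p = H₁ f y (F f y p) p)
    (hodd : ∀ f p y, F f (2 * y + 1) p = H₂ f y (F f y p) p)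
    (hbound : ∀ f p u, Nat.size (F f u p) ≤ Nat.size (K f u p)) : B2 F := by
  intro l' u p hu hp
  have main : BFF k (l + 1) (fun f z => F f (z (Fin.last l)) (fun j => z j.castSucc)) := by
    refine BFF.lrn (G := G)
      (H₁ := fun f z => H₁ f (z (Fin.last l).castSucc) (z (Fin.last (l + 1)))
        (fun j => z j.castSucc.castSucc))
      (H₂ := fun f z => H₂ f (z (Fin.last l).castSucc) (z (Fin.last (l + 1)))
        (fun j => z j.castSucc.castSucc))
      (K := fun f z => K f (z (Fin.last l)) (fun j => z j.castSucc)) _ hG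
      (hH₁ _ _ _ _ (var _) (var _) (fun j => var _))
      (hH₂ _ _ _ _ (var _) (var _) (fun j => var _))
      (hK _ _ _ (var _) (fun j => var _)) ?_ ?_ ?_ ?_
    · intro f x; simp [hbase]
    · intro f x y hy; simp [heven _ _ _ hy]
    · intro f x y; simp [hodd]
    · intro f x; exact hbound _ _ _
  have := comp' (G := Fin.snoc (α := fun _ => (Fin k → ℕ → ℕ) → (Fin l' → ℕ) → ℕ) p u) main
    (fun i => by
      refine Fin.lastCases ?_ (fun j => ?_) i
      · simpa using hu
      · simpa using hp j)
  simpa using this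

/-! ### Basic functions -/

theorem size_two_mul {y : ℕ} (hy : 0 < y) : Nat.size (2 * y) = Nat.size y + 1 := by
  have := Nat.size_bit (b := false) (n := y) (by simp [Nat.bit]; omega)
  simpa [Nat.bit] using this

theorem size_two_mul_add (y : ℕ) : Nat.size (2 * y + 1) = Nat.size y + 1 := by
  have := Nat.size_bit (b := true) (n := y) (by simp [Nat.bit])
  simpa [Nat.bit] using this

theorem size_smash (a b : ℕ) : Nat.size (smash a b) = Nat.size a * Nat.size b + 1 := by
  unfold smash; exact Nat.size_pow

theorem size_div (a n : ℕ) : Nat.size (a / 2 ^ n) = Nat.size a - n := by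
  have key : ∀ s, Nat.size (a / 2 ^ n) ≤ s ↔ Nat.size a - n ≤ s := by
    intro s
    rw [Nat.size_le, Nat.div_lt_iff_lt_mul (by positivity), ← pow_add, ← Nat.size_le]
    omega
  exact le_antisymm ((key _).2 le_rfl) ((key _).1 le_rfl)

/-- A bound dominating both lengths. -/
def big (a b : ℕ) : ℕ := smash (2 * a + 1) (2 * b + 1)

theorem size_big (a b : ℕ) :
    Nat.size (big a b) = (Nat.size a + 1) * (Nat.size b + 1) + 1 := by
  rw [big, size_smash, size_two_mul_add, size_two_mul_add]

theorem size_big_add (a b : ℕ) : Nat.size a + Nat.size b ≤ Nat.size (big a b) := by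
  rw [size_big]; nlinarith

/-- The auxiliary bit-copying recursion. -/
def cpy (x z m : ℕ) : ℕ → ℕ
  | 0 => x
  | s + 1 => 2 * cpy x z m s + (z / 2 ^ (m - (s + 1))) % 2

theorem cpy_eq (x z m s : ℕ) (h : s ≤ m) :
    cpy x z m s = x * 2 ^ s + (z / 2 ^ (m - s)) % 2 ^ s := by
  induction s with
  | zero => simp [cpy, Nat.mod_one]
  | succ s ih =>
    rw [cpy, ih (by omega)]
    have e : m - s = (m - (s + 1)) + 1 := by omega
    rw [e, pow_succ 2 (m - (s + 1)), ← Nat.div_div_eq_div_mul]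
    generalize z / 2 ^ (m - (s + 1)) = w
    rw [pow_succ' 2 s, Nat.mod_mul]
    ring

theorem cpy_lt (x z m s : ℕ) : cpy x z m s + 1 ≤ (x + 1) * 2 ^ s := by
  induction s with
  | zero => simp [cpy]
  | succ s ih =>
    rw [cpy, pow_succ]
    have : (z / 2 ^ (m - (s + 1))) % 2 < 2 := Nat.mod_lt _ (by norm_num)
    nlinarith

theorem size_cpy (x z m s : ℕ) : Nat.size (cpy x z m s) ≤ Nat.size x + s := by
  rw [Nat.size_le, pow_add]
  have h1 := cpy_lt x z m s
  have h2 : x + 1 ≤ 2 ^ Nat.size x := Nat.lt_size_self x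
  have := Nat.mul_le_mul_right (2 ^ s) h2
  omega

section
variable {k l : ℕ} {a b c d : (Fin k → ℕ → ℕ) → (Fin l → ℕ) → ℕ}

theorem bigB (ha : BFF k l a) (hb : BFF k l b) : BFF k l (fun f x => big (a f x) (b f x)) :=
  sm (dbl1 ha) (dbl1 hb)

theorem half (ha : BFF k l a) : BFF k l (fun f x => a f x / 2) := by
  have : B2 (k := k) (l := 1) (fun _ u _ => u / 2) := by
    refine lrn' _ (fun _ _ => 0) (fun _ y _ _ => y) (fun _ y _ _ => y) (fun _ u _ => u)
      (const0 (by omega)) ?_ ?_ ?_ ?_ ?_ ?_ ?_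
    · intro l' u r p hu hr hp; exact hu
    · intro l' u r p hu hr hp; exact hu
    · intro l' u p hu hp; exact hu
    · intros; rfl
    · intros; omega
    · intros; omega
    · intro f p u; exact Nat.size_le_size (by omega)
  exact this l a (fun _ => a) ha (fun _ => ha)

theorem par (ha : BFF k l a) : BFF k l (fun f x => a f x % 2) := by
  have : B2 (k := k) (l := 1) (fun _ u _ => u % 2) := by
    refine lrn' _ (fun _ _ => 0) (fun _ y _ _ => 0) (fun _ y _ _ => 2 * 0 + 1) (fun _ u _ => u)
      (const0 (by omega)) ?_ ?_ ?_ ?_ ?_ ?_ ?_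
    · intro l' u r p hu hr hp; exact const0 (pos hu)
    · intro l' u r p hu hr hp; exact dbl1 (const0 (pos hu))
    · intro l' u p hu hp; exact hu
    · intros; rfl
    · intros; omega
    · intros; omega
    · intro f p u; exact Nat.size_le_size (by omega)
  exact this l a (fun _ => a) ha (fun _ => ha)

theorem cond (hc : BFF k l c) (ha : BFF k l a) (hb : BFF k l b) :
    BFF k l (fun f x => if c f x = 0 then a f x else b f x) := by
  have : B2 (k := k) (l := 2) (fun _ u p => if u = 0 then p 0 else p 1) := by
    refine lrn' _ (fun _ p => p 0) (fun _ _ _ p => p 1) (fun _ _ _ p => p 1)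
      (fun _ _ p => big (p 0) (p 1)) (var 0) ?_ ?_ ?_ ?_ ?_ ?_ ?_
    · intro l' u r p hu hr hp; exact hp 1
    · intro l' u r p hu hr hp; exact hp 1
    · intro l' u p hu hp; exact bigB (hp 0) (hp 1)
    · intros; rfl
    · intro f p y hy; rw [if_neg (by omega)]
    · intro f p y; rw [if_neg (by omega)]
    · intro f p u
      have := size_big_add (p 0) (p 1)
      split <;> omega
  have := this l c ![a, b] hc (fun i => by fin_cases i <;> assumption)
  simpa using this

theorem msp (ha : BFF k l a) (hb : BFF k l b) :
    BFF k l (fun f x => a f x / 2 ^ Nat.size (b f x)) := by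
  have : B2 (k := k) (l := 1) (fun _ u p => p 0 / 2 ^ Nat.size u) := by
    refine lrn' _ (fun _ p => p 0) (fun _ _ r _ => r / 2) (fun _ _ r _ => r / 2)
      (fun _ _ p => p 0) (var 0) ?_ ?_ ?_ ?_ ?_ ?_ ?_
    · intro l' u r p hu hr hp; exact half hr
    · intro l' u r p hu hr hp; exact half hr
    · intro l' u p hu hp; exact hp 0
    · intros; simp
    · intro f p y hy; rw [size_two_mul hy, pow_succ, Nat.div_div_eq_div_mul]
    · intro f p y; rw [size_two_mul_add, pow_succ, Nat.div_div_eq_div_mul]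
    · intro f p u; exact Nat.size_le_size (Nat.div_le_self _ _)
  exact this l b (fun _ => a) hb (fun _ => ha)

theorem pk (ha : BFF k l a) (hb : BFF k l b) (hc : BFF k l c) :
    BFF k l (fun f x => a f x * 2 ^ Nat.size (c f x) + b f x % 2 ^ Nat.size (c f x)) := by
  have : B2 (k := k) (l := 3) (fun _ u p => cpy (p 0) (p 1) (Nat.size (p 2)) (Nat.size u)) := by
    have hH : B2' (k := k) (l := 3) (fun _ y r p =>
        if (p 1 / 2 ^ Nat.size (p 2 / 2 ^ Nat.size (2 * y + 1))) % 2 = 0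
          then 2 * r else 2 * r + 1) := by
      intro l' u r p hu hr hp
      exact cond (par (msp (hp 1) (msp (hp 2) (dbl1 hu)))) (dbl hr) (dbl1 hr)
    refine lrn' _ (fun _ p => p 0) _ _
      (fun _ u p => big (p 0) u) (var 0) hH hH ?_ ?_ ?_ ?_ ?_
    · intro l' u p hu hp; exact bigB (hp 0) hu
    · intros; simp [cpy]
    · intro f p y hy
      rw [size_two_mul hy, size_div, size_two_mul_add, cpy]
      split <;> omega
    · intro f p y
      rw [size_div, size_two_mul_add, cpy]
      split <;> omega
    · intro f p u
      exact (size_cpy _ _ _ _).trans (size_big_add _ _)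
  have := this l c ![a, b, c] hc (fun i => by fin_cases i <;> assumption)
  convert this using 3
  simp [cpy_eq]

theorem trunc (ha : BFF k l a) (hb : BFF k l b) :
    BFF k l (fun f x => a f x % 2 ^ Nat.size (b f x)) := by
  have := pk (const0 (pos ha)) ha hb
  simpa using this

end

/-! ### Coding of tuples -/

/-- Fixed-width tuple coding. -/
def enc (m : ℕ) : (n : ℕ) → (Fin n → ℕ) → ℕ
  | 0, _ => 0
  | n + 1, v => enc m n (fun i => v i.succ) * 2 ^ m + v 0 % 2 ^ m

/-- Fixed-width tuple decoding. -/
def dec (m : ℕ) : ℕ → ℕ → ℕ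
  | 0, z => z % 2 ^ m
  | i + 1, z => dec m i (z / 2 ^ m)

theorem dec_enc (m n : ℕ) (v : Fin n → ℕ) (i : Fin n) :
    dec m i (enc m n v) = v i % 2 ^ m := by
  induction n with
  | zero => exact i.elim0
  | succ n ih =>
    refine Fin.cases ?_ (fun j => ?_) i
    · simp [dec, enc]
    · simp only [Fin.val_succ, dec, enc]
      have h : v 0 % 2 ^ m < 2 ^ m := Nat.mod_lt _ (by positivity)
      rw [mul_comm, Nat.mul_add_div (by positivity), Nat.div_eq_of_lt h, add_zero]
      exact ih _ j

theorem enc_lt (m n : ℕ) (v : Fin n → ℕ) : enc m n v < 2 ^ (m * n) := by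
  induction n with
  | zero => simp [enc]
  | succ n ih =>
    rw [enc, Nat.mul_succ, pow_add]
    have h : v 0 % 2 ^ m < 2 ^ m := Nat.mod_lt _ (by positivity)
    have h2 : enc m n (fun i => v i.succ) + 1 ≤ 2 ^ (m * n) := ih (fun i => v i.succ)
    have h3 := Nat.mul_le_mul_right (2 ^ m) h2
    rw [Nat.add_mul] at h3
    omega

theorem enc_mod (m n : ℕ) (v : Fin n → ℕ) : enc m n (fun i => v i % 2 ^ m) = enc m n v := by
  induction n with
  | zero => rfl
  | succ n ih =>
    simp only [enc, Nat.mod_mod]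
    rw [ih (fun i => v i.succ)]

theorem encB {k l n : ℕ} {b : (Fin k → ℕ → ℕ) → (Fin l → ℕ) → ℕ} (hb : BFF k l b)
    (v : Fin n → (Fin k → ℕ → ℕ) → (Fin l → ℕ) → ℕ) (hv : ∀ i, BFF k l (v i)) :
    BFF k l (fun f x => enc (Nat.size (b f x)) n (fun i => v i f x)) := by
  induction n with
  | zero => exact const0 (pos hb)
  | succ n ih => exact pk (ih (fun i => v i.succ) (fun i => hv _)) (hv 0) hb

theorem decB {k l : ℕ} (i : ℕ) {a b : (Fin k → ℕ → ℕ) → (Fin l → ℕ) → ℕ} (hb : BFF k l b)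
    (ha : BFF k l a) : BFF k l (fun f x => dec (Nat.size (b f x)) i (a f x)) := by
  induction i generalizing a with
  | zero => exact trunc ha hb
  | succ n ih => exact ih (msp ha hb)

theorem constB {k l : ℕ} (hl : 0 < l) (n : ℕ) :
    ∃ c : ℕ, Nat.size c = n ∧ BFF k l (fun _ _ => c) := by
  induction n with
  | zero => exact ⟨0, by simp, const0 hl⟩
  | succ n ih =>
    obtain ⟨c, h1, h2⟩ := ih
    exact ⟨2 * c + 1, by rw [size_two_mul_add, h1], dbl1 h2⟩

/-! ### Truncated simultaneous recursion -/

/-- Recursion on notation for a tuple. -/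
def trec {n : ℕ} (g : Fin n → ℕ) (s : ℕ → (Fin n → ℕ) → (Fin n → ℕ)) (u : ℕ) : Fin n → ℕ :=
  if h : u = 0 then g else s u (trec g s (u / 2))
termination_by u
decreasing_by omega

theorem trec_zero {n : ℕ} (g : Fin n → ℕ) (s) : trec g s 0 = g := by
  rw [trec]; simp

theorem trec_pos {n : ℕ} (g : Fin n → ℕ) (s) {u : ℕ} (h : 0 < u) :
    trec g s u = s u (trec g s (u / 2)) := by
  rw [trec]; simp [h.ne']

theorem truncRec {k n l : ℕ} (hl : 0 < l)
    (B : (Fin k → ℕ → ℕ) → (Fin l → ℕ) → ℕ) (hB : BFF k l B)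
    (G : Fin n → (Fin k → ℕ → ℕ) → (Fin l → ℕ) → ℕ) (hG : ∀ i, BFF k l (G i))
    (S : Fin n → (Fin k → ℕ → ℕ) → ℕ → (Fin n → ℕ) → (Fin l → ℕ) → ℕ) (hS : ∀ i, B3 (S i)) :
    ∃ T : Fin n → (Fin k → ℕ → ℕ) → ℕ → (Fin l → ℕ) → ℕ, (∀ i, B2 (T i)) ∧
      (∀ i f p, T i f 0 p = G i f p % 2 ^ Nat.size (B f p)) ∧
      (∀ i f p u, 0 < u → T i f u p =
        S i f u (fun j => T j f (u / 2) p) p % 2 ^ Nat.size (B f p)) := by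
  let T : Fin n → (Fin k → ℕ → ℕ) → ℕ → (Fin l → ℕ) → ℕ := fun i f u p =>
    trec (fun i => G i f p % 2 ^ Nat.size (B f p))
      (fun u y i => S i f u y p % 2 ^ Nat.size (B f p)) u i
  have h0 : ∀ i f p, T i f 0 p = G i f p % 2 ^ Nat.size (B f p) := by
    intro i f p; simp only [T, trec_zero]
  have h1 : ∀ i f p u, 0 < u → T i f u p =
        S i f u (fun j => T j f (u / 2) p) p % 2 ^ Nat.size (B f p) := by
    intro i f p u hu; simp only [T]; rw [trec_pos _ _ hu]
  have hlt : ∀ i f p u, T i f u p % 2 ^ Nat.size (B f p) = T i f u p := by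
    intro i f p u
    rcases Nat.eq_zero_or_pos u with rfl | hu
    · rw [h0, Nat.mod_mod]
    · rw [h1 _ _ _ _ hu, Nat.mod_mod]
  refine ⟨T, ?_, h0, h1⟩
  obtain ⟨c, hc, hcl⟩ := constB (k := k) hl n
  have hcB : ∀ l', 0 < l' → BFF k l' (fun _ _ => c) := by
    intro l' hl'
    exact comp' hcl (fun _ => var ⟨0, hl'⟩)
  have hBB : ∀ (l' : ℕ) (p : Fin l → (Fin k → ℕ → ℕ) → (Fin l' → ℕ) → ℕ),
      (∀ j, BFF k l' (p j)) → BFF k l' (fun f z => B f (fun j => p j f z)) :=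
    fun l' p hp => comp' hB hp
  -- the coded functional
  have code : B2 (k := k) (l := l) (fun f u p =>
      enc (Nat.size (B f p)) n (fun i => T i f u p)) := by
    refine lrn' _ (fun f p => enc (Nat.size (B f p)) n (fun i => G i f p))
      (fun f y r p => enc (Nat.size (B f p)) n (fun i =>
        S i f (2 * y) (fun j => dec (Nat.size (B f p)) j r) p))
      (fun f y r p => enc (Nat.size (B f p)) n (fun i =>
        S i f (2 * y + 1) (fun j => dec (Nat.size (B f p)) j r) p))
      (fun f _ p => smash (B f p) c) (encB hB _ hG) ?_ ?_ ?_ ?_ ?_ ?_ ?_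
    · intro l' u r p hu hr hp
      exact encB (hBB _ _ hp) _ (fun i => hS i _ _ _ _ (dbl hu)
        (fun j => decB _ (hBB _ _ hp) hr) hp)
    · intro l' u r p hu hr hp
      exact encB (hBB _ _ hp) _ (fun i => hS i _ _ _ _ (dbl1 hu)
        (fun j => decB _ (hBB _ _ hp) hr) hp)
    · intro l' u p hu hp
      exact sm (hBB _ _ hp) (hcB _ (pos hu))
    · intro f p
      have : (fun i => T i f 0 p) = fun i => G i f p % 2 ^ Nat.size (B f p) := by
        funext i; exact h0 i f p
      rw [this, enc_mod]
    · intro f p y hy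
      have : (fun i => T i f (2 * y) p) = fun i =>
          S i f (2 * y) (fun j => T j f y p) p % 2 ^ Nat.size (B f p) := by
        funext i; rw [h1 i f p (2 * y) (by omega), Nat.mul_div_cancel_left _ (by omega)]
      rw [this, enc_mod]
      simp only [dec_enc, hlt]
    · intro f p y
      have e : (2 * y + 1) / 2 = y := by omega
      have : (fun i => T i f (2 * y + 1) p) = fun i =>
          S i f (2 * y + 1) (fun j => T j f y p) p % 2 ^ Nat.size (B f p) := by
        funext i; rw [h1 i f p (2 * y + 1) (by omega), e]
      rw [this, enc_mod]
      simp only [dec_enc, hlt]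
    · intro f p u
      rw [size_smash, hc]
      exact (Nat.size_le.2 (enc_lt _ _ _)).trans (Nat.le_succ _)
  intro i l' u p hu hp
  have := decB i (hBB _ _ hp) (code l' u p hu hp)
  simpa only [dec_enc, hlt] using this


theorem B2.cons {k l l' : ℕ} {Φ : (Fin k → ℕ → ℕ) → ℕ → (Fin (l + 1) → ℕ) → ℕ} (h : B2 Φ)
    {u b : (Fin k → ℕ → ℕ) → (Fin l' → ℕ) → ℕ}
    {x : Fin l → (Fin k → ℕ → ℕ) → (Fin l' → ℕ) → ℕ}
    (hu : BFF k l' u) (hb : BFF k l' b) (hx : ∀ j, BFF k l' (x j)) :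
    BFF k l' (fun f z => Φ f (u f z) (Fin.cons (b f z) (fun j => x j f z))) := by
  have := h l' u (Fin.cons (α := fun _ => (Fin k → ℕ → ℕ) → (Fin l' → ℕ) → ℕ) b x) hu
    (fun i => by
      refine Fin.cases ?_ (fun j => ?_) i
      · simpa using hb
      · simpa using hx j)
  convert this using 4
  rename_i f z
  funext j
  refine Fin.cases ?_ (fun j => ?_) j <;> simp

theorem mod_of_size {a b : ℕ} (h : Nat.size a ≤ Nat.size b) : a % 2 ^ Nat.size b = a :=
  Nat.mod_eq_of_lt (Nat.size_le.1 h)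

theorem size_half (u : ℕ) : Nat.size (u / 2) ≤ Nat.size u := Nat.size_le_size (by omega)

theorem div_shift (u s : ℕ) : u / 2 / 2 ^ s = u / 2 ^ (s + 1) := by
  rw [Nat.div_div_eq_div_mul, pow_succ']

section
variable {k n l : ℕ}

/-- `T` computes `F` from a parameter bounding the input and the first `j` components. -/
def Good (F : Fin n → (Fin k → ℕ → ℕ) → ℕ → (Fin l → ℕ) → ℕ) (j : ℕ)
    (T : Fin n → (Fin k → ℕ → ℕ) → ℕ → (Fin (l + 1) → ℕ) → ℕ) : Prop :=
  (∀ i, B2 (T i)) ∧ ∀ f u b x, Nat.size u ≤ Nat.size b →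
    (∀ s (i : Fin n), i.val < j → Nat.size (F i f (u / 2 ^ s) x) ≤ Nat.size b) →
    ∀ i, T i f u (Fin.cons b x) = F i f u x

variable (G : Fin n → (Fin k → ℕ → ℕ) → (Fin l → ℕ) → ℕ)
    (H K : Fin n → (Fin k → ℕ → ℕ) → ℕ → (Fin n → ℕ) → (Fin l → ℕ) → ℕ)
    (F : Fin n → (Fin k → ℕ → ℕ) → ℕ → (Fin l → ℕ) → ℕ)

theorem good_top (hG : ∀ i, BFF k l (G i)) (hH : ∀ i, B3 (H i))
    (hbase : ∀ i f x, F i f 0 x = G i f x)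
    (hrec : ∀ i f x u, 0 < u → F i f u x = H i f u (fun j => F j f (u / 2) x) x) :
    ∃ T, Good F n T := by
  obtain ⟨T, hT, h0, h1⟩ := truncRec (k := k) (n := n) (l := l + 1) (by omega)
    (fun _ p => p 0) (var 0)
    (fun i f p => G i f (fun j => p j.succ)) (fun i => comp' (hG i) (fun j => var _))
    (fun i f u y p => H i f u y (fun j => p j.succ))
    (fun i l' u y p hu hy hp => hH i _ _ _ _ hu hy (fun j => hp _))
  refine ⟨T, hT, ?_⟩
  intro f u b x
  induction u using Nat.strong_induction_on with
  | _ u ih =>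
    intro hu hb i
    have hi : Nat.size (F i f u x) ≤ Nat.size b := by simpa using hb 0 i i.isLt
    rcases Nat.eq_zero_or_pos u with rfl | hpos
    · rw [h0]
      simp only [Fin.cons_zero, Fin.cons_succ]
      rw [← hbase, mod_of_size hi]
    · rw [h1 _ _ _ _ hpos]
      have e : (fun j => T j f (u / 2) (Fin.cons b x)) = fun j => F j f (u / 2) x := by
        funext j
        refine ih (u / 2) (by omega) ((size_half u).trans hu) ?_ j
        intro s i' hi'
        rw [div_shift]
        exact hb _ _ hi'
      simp only [e, Fin.cons_zero, Fin.cons_succ]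
      rw [← hrec _ _ _ _ hpos, mod_of_size hi]

theorem good_step (hG : ∀ i, BFF k l (G i)) (hH : ∀ i, B3 (H i)) (hK : ∀ i, B3 (K i))
    (hdep : ∀ i f u y y' x, (∀ j, j < i → y j = y' j) → K i f u y x = K i f u y' x)
    (hbase : ∀ i f x, F i f 0 x = G i f x)
    (hrec : ∀ i f x u, 0 < u → F i f u x = H i f u (fun j => F j f (u / 2) x) x)
    (hbd : ∀ i f x u, F i f u x ≤ K i f u (fun j => F j f u x) x)
    (j : Fin n) (T : Fin n → (Fin k → ℕ → ℕ) → ℕ → (Fin (l + 1) → ℕ) → ℕ)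
    (hT : Good F (j.val + 1) T) : ∃ T', Good F j.val T' := by
  obtain ⟨hTB, hTF⟩ := hT
  -- the ingredients of the recursion step
  let Ko : (Fin k → ℕ → ℕ) → (Fin (n + 1) → ℕ) → (Fin l → ℕ) → ℕ := fun f y x =>
    K j f (y 0) (fun i => y i.succ) x
  let N : Fin n → (Fin k → ℕ → ℕ) → ℕ → (Fin (n + 1) → ℕ) → (Fin (l + 1) → ℕ) → ℕ :=
    fun i f u y p => H i f u (fun i' => T i' f (u / 2)
      (Fin.cons (big (p 0) (Ko f y (fun j => p j.succ))) (fun j => p j.succ)))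
      (fun j => p j.succ)
  let Kn : (Fin k → ℕ → ℕ) → ℕ → (Fin (n + 1) → ℕ) → (Fin (l + 1) → ℕ) → ℕ :=
    fun f u y p => K j f u (fun i => N i f u y p) (fun j => p j.succ)
  let tst : (Fin k → ℕ → ℕ) → ℕ → (Fin (n + 1) → ℕ) → (Fin (l + 1) → ℕ) → ℕ :=
    fun f u y p => Kn f u y p / 2 ^ Nat.size (Ko f y (fun j => p j.succ))
  let S : Fin (n + 1) → (Fin k → ℕ → ℕ) → ℕ → (Fin (n + 1) → ℕ) → (Fin (l + 1) → ℕ) → ℕ :=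
    fun i f u y p => if tst f u y p = 0 then y i else
      (Fin.cons u (fun i' => N i' f u y p) : Fin (n + 1) → ℕ) i
  have hN : ∀ i, B3 (N i) := by
    intro i l' u y p hu hy hp
    exact hH i _ _ _ _ hu (fun i' => B2.cons (hTB i') (half hu)
      (bigB (hp 0) (hK j _ _ _ _ (hy 0) (fun i => hy _) (fun j => hp _))) (fun j => hp _))
      (fun j => hp _)
  have htst : B3 tst := by
    intro l' u y p hu hy hp
    exact msp (hK j _ _ _ _ hu (fun i => hN i _ _ _ _ hu hy hp) (fun j => hp _))
      (hK j _ _ _ _ (hy 0) (fun i => hy _) (fun j => hp _))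
  have hS : ∀ i, B3 (S i) := by
    intro i l' u y p hu hy hp
    refine Fin.cases ?_ (fun i' => ?_) i
    · exact cond (htst _ _ _ _ hu hy hp) (hy _) hu
    · exact cond (htst _ _ _ _ hu hy hp) (hy _) (hN i' _ _ _ _ hu hy hp)
  obtain ⟨P, hP, hP0, hP1⟩ := truncRec (k := k) (n := n + 1) (l := l + 1) (by omega)
    (fun _ p => p 0) (var 0)
    (fun i f p => (Fin.cons 0 (fun i' => G i' f (fun j => p j.succ)) : Fin (n + 1) → ℕ) i)
    (fun i => by
      refine Fin.cases ?_ (fun i' => ?_) i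
      · exact const0 (by omega)
      · exact comp' (hG i') (fun j => var _))
    S hS
  have hPm : ∀ i f p u, P i f u p % 2 ^ Nat.size (p 0) = P i f u p := by
    intro i f p u
    rcases Nat.eq_zero_or_pos u with rfl | hu
    · rw [hP0, Nat.mod_mod]
    · rw [hP1 _ _ _ _ hu, Nat.mod_mod]
  -- from the invariant, the derived bound is good
  have hgood : ∀ f u b x (y : Fin (n + 1) → ℕ), Nat.size u ≤ Nat.size b →
      (∀ s (i : Fin n), i.val < j.val → Nat.size (F i f (u / 2 ^ s) x) ≤ Nat.size b) →
      (∀ s, Nat.size (K j f (u / 2 ^ s) (fun i => F i f (u / 2 ^ s) x) x)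
        ≤ Nat.size (Ko f y x)) →
      ∀ i, T i f u (Fin.cons (big b (Ko f y x)) x) = F i f u x := by
    intro f u b x y hu hb hinv
    have hsz := size_big_add b (Ko f y x)
    refine hTF f u _ x (by omega) ?_
    intro s i hi
    rcases Nat.lt_or_ge i.val j.val with h | h
    · have := hb s i h; omega
    · obtain rfl : i = j := Fin.ext (by omega)
      have h1 := Nat.size_le_size (hbd i f x (u / 2 ^ s))
      have h2 := hinv s
      omega
  -- the invariant
  have inv : ∀ f b x u, Nat.size u ≤ Nat.size b →
      (∀ s (i : Fin n), i.val < j.val → Nat.size (F i f (u / 2 ^ s) x) ≤ Nat.size b) →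
      (∀ s, Nat.size (K j f (u / 2 ^ s) (fun i => F i f (u / 2 ^ s) x) x)
        ≤ Nat.size (Ko f (fun i => P i f u (Fin.cons b x)) x)) := by
    intro f b x u
    induction u using Nat.strong_induction_on with
    | _ u ih =>
      intro hu hb
      rcases Nat.eq_zero_or_pos u with rfl | hpos
      · intro s
        simp only [Nat.zero_div] at hb ⊢
        apply le_of_eq
        congr 1
        simp only [Ko, hP0, Fin.cons_zero, Fin.cons_succ, Nat.zero_mod]
        refine hdep _ _ _ _ _ _ ?_
        intro i hi
        rw [← hbase, mod_of_size (hb 0 i hi)]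
      · have hu' := (size_half u).trans hu
        have hb' : ∀ s (i : Fin n), i.val < j.val →
            Nat.size (F i f (u / 2 / 2 ^ s) x) ≤ Nat.size b := by
          intro s i hi; rw [div_shift]; exact hb _ _ hi
        have hI := ih (u / 2) (by omega) hu' hb'
        have hw := hgood f (u / 2) b x (fun i => P i f (u / 2) (Fin.cons b x)) hu' hb' hI
        set y : Fin (n + 1) → ℕ := fun i => P i f (u / 2) (Fin.cons b x) with hy
        have hNF : ∀ i, N i f u y (Fin.cons b x) = F i f u x := by
          intro i
          simp only [N, Fin.cons_zero, Fin.cons_succ, hw]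
          exact (hrec _ _ _ _ hpos).symm
        have hKn : Kn f u y (Fin.cons b x) = K j f u (fun i => F i f u x) x := by
          simp only [Kn, hNF, Fin.cons_succ]
        have hpu : ∀ i, P i f u (Fin.cons b x) =
            S i f u y (Fin.cons b x) % 2 ^ Nat.size b := by
          intro i
          rw [hP1 _ _ _ _ hpos]
          simp only [Fin.cons_zero, hy]
        have htv : tst f u y (Fin.cons b x) =
            K j f u (fun i => F i f u x) x / 2 ^ Nat.size (Ko f y x) := by
          simp only [tst, hKn, Fin.cons_succ]
        -- the maximum is attained or kept
        have hmain : Nat.size (K j f u (fun i => F i f u x) x) ≤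
              Nat.size (Ko f (fun i => P i f u (Fin.cons b x)) x) ∧
            Nat.size (Ko f y x) ≤ Nat.size (Ko f (fun i => P i f u (Fin.cons b x)) x) := by
          have hsd := size_div (K j f u (fun i => F i f u x) x) (Nat.size (Ko f y x))
          rw [← htv] at hsd
          by_cases ht : tst f u y (Fin.cons b x) = 0
          · have e : (fun i => P i f u (Fin.cons b x)) = y := by
              funext i
              rw [hpu]
              simp only [S, ht, if_true]
              have := hPm i f (Fin.cons b x) (u / 2)
              simpa [hy] using this
            rw [e]
            rw [ht, Nat.size_zero] at hsd
            omega
          · have hne : Nat.size (tst f u y (Fin.cons b x)) ≠ 0 := by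
              intro h; exact ht (Nat.size_eq_zero.1 h)
            have e : Ko f (fun i => P i f u (Fin.cons b x)) x =
                K j f u (fun i => F i f u x) x := by
              simp only [Ko, hpu, S, if_neg ht, Fin.cons_zero, Fin.cons_succ, hNF]
              rw [mod_of_size hu]
              refine hdep _ _ _ _ _ _ ?_
              intro i hi
              refine mod_of_size ?_
              simpa using hb 0 i hi
            rw [e]
            omega
        intro s
        cases s with
        | zero => simpa using hmain.1
        | succ s =>
          have := hI s
          simp only [div_shift] at this
          exact this.trans hmain.2
  refine ⟨fun i f u p => T i f u (Fin.cons (big (p 0)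
    (Ko f (fun i => P i f u p) (fun j => p j.succ))) (fun j => p j.succ)), ?_, ?_⟩
  · intro i l' u p hu hp
    exact B2.cons (hTB i) hu (bigB (hp 0) (hK j _ _ _ _ (hP 0 _ _ _ hu hp)
      (fun i => hP i.succ _ _ _ hu hp) (fun j => hp _))) (fun j => hp _)
  · intro f u b x hu hb i
    simp only [Fin.cons_zero, Fin.cons_succ]
    exact hgood f u b x (fun i => P i f u (Fin.cons b x)) hu hb (inv f b x u hu hb) i

theorem main (hG : ∀ i, BFF k l (G i)) (hH : ∀ i, B3 (H i)) (hK : ∀ i, B3 (K i))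
    (hdep : ∀ i f u y y' x, (∀ j, j < i → y j = y' j) → K i f u y x = K i f u y' x)
    (hbase : ∀ i f x, F i f 0 x = G i f x)
    (hrec : ∀ i f x u, 0 < u → F i f u x = H i f u (fun j => F j f (u / 2) x) x)
    (hbd : ∀ i f x u, F i f u x ≤ K i f u (fun j => F j f u x) x) (i : Fin n) :
    B2 (F i) := by
  have key : ∀ d, d ≤ n → ∃ T, Good F (n - d) T := by
    intro d
    induction d with
    | zero => intro _; exact good_top G H F hG hH hbase hrec
    | succ d ih =>
      intro hd
      obtain ⟨T, hT⟩ := ih (by omega)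
      have e : n - d = (n - (d + 1)) + 1 := by omega
      rw [e] at hT
      exact good_step G H K F hG hH hK hdep hbase hrec hbd ⟨n - (d + 1), by omega⟩ T hT
  obtain ⟨T, hTB, hTF⟩ := key n le_rfl
  intro l' u p hu hp
  have := B2.cons (hTB i) hu hu hp
  convert this using 3
  rename_i f z
  refine (hTF f _ _ _ le_rfl ?_ i).symm
  intro s i' hi'
  omega

end

end BFFAux

/-- Multiple limited recursion on notation for `n ≥ 1` functionals, where the bound on `Fᵢ`
may depend on the values of the earlier functionals `F₁, …, F_{i-1}`:
if `Fᵢ(0,α⃗) = Gᵢ(α⃗)`, `Fᵢ(u,α⃗) = Hᵢ(u, F₁(⌊u/2⌋,α⃗), …, Fₙ(⌊u/2⌋,α⃗), α⃗)` for `u > 0`, and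
`Fᵢ(u,α⃗) ≤ Kᵢ(u, α⃗, F₁(u,α⃗), …, F_{i-1}(u,α⃗))`, with all `Gᵢ, Hᵢ, Kᵢ` basic feasible,
then each `Fᵢ` is basic feasible. -/
theorem bff_n_fold_multiple_limited_recursion_on_notation (n k l : ℕ) (hn : 1 ≤ n)
    (G : Fin n → (Fin k → ℕ → ℕ) → (Fin l → ℕ) → ℕ)
    (H : Fin n → (Fin k → ℕ → ℕ) → (Fin (n + l + 1) → ℕ) → ℕ)
    (K : (i : Fin n) → (Fin k → ℕ → ℕ) → (Fin (l + i.val + 1) → ℕ) → ℕ)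
    (F : Fin n → (Fin k → ℕ → ℕ) → (Fin (l + 1) → ℕ) → ℕ)
    (hG : ∀ i, BFF k l (G i))
    (hH : ∀ i, BFF k (n + l + 1) (H i))
    (hK : ∀ i, BFF k (l + i.val + 1) (K i))
    (hbase : ∀ i f x, F i f (Fin.cons 0 x) = G i f x)
    (hrec : ∀ i f x u, 0 < u → F i f (Fin.cons u x) =
      H i f (Fin.cons u (Fin.append (fun j => F j f (Fin.cons (u / 2) x)) x)))
    (hbd : ∀ i f x u, F i f (Fin.cons u x) ≤
      K i f (Fin.cons u (Fin.append x
        (fun j : Fin i.val => F ⟨j.val, j.isLt.trans i.isLt⟩ f (Fin.cons u x))))) :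
    ∀ i, BFF k (l + 1) (F i) := by
  intro i
  have h := BFFAux.main (k := k) (n := n) (l := l) G
    (fun i f u y x => H i f (Fin.cons u (Fin.append y x)))
    (fun i f u y x => K i f (Fin.cons u (Fin.append x
      (fun j : Fin i.val => y ⟨j.val, j.isLt.trans i.isLt⟩))))
    (fun i f u x => F i f (Fin.cons u x)) hG
    (by
      intro i l' u y p hu hy hp
      refine BFFAux.comp' (G := fun (t : Fin (n + l + 1)) f z =>
        (Fin.cons (u f z) (Fin.append (fun j => y j f z) (fun j => p j f z)) :
          Fin (n + l + 1) → ℕ) t) (hH i) ?_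
      intro t
      refine Fin.cases ?_ (fun t => ?_) t
      · simpa using hu
      · refine Fin.addCases (fun t => ?_) (fun t => ?_) t
        · simpa using hy t
        · simpa using hp t)
    (by
      intro i l' u y p hu hy hp
      refine BFFAux.comp' (G := fun (t : Fin (l + i.val + 1)) f z =>
        (Fin.cons (u f z) (Fin.append (fun j => p j f z)
          (fun j : Fin i.val => y ⟨j.val, j.isLt.trans i.isLt⟩ f z)) :
          Fin (l + i.val + 1) → ℕ) t) (hK i) ?_
      intro t
      refine Fin.cases ?_ (fun t => ?_) t
      · simpa using hu
      · refine Fin.addCases (fun t => ?_) (fun t => ?_) t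
        · simpa using hp t
        · simpa using hy _)
    (by
      intro i f u y y' x hyy
      have : (fun j : Fin i.val => y ⟨j.val, j.isLt.trans i.isLt⟩) =
          fun j : Fin i.val => y' ⟨j.val, j.isLt.trans i.isLt⟩ := by
        funext j
        exact hyy _ j.isLt
      simp only [this])
    hbase hrec hbd i
  have h2 := h (l + 1) (fun _ z => z 0) (fun j _ z => z j.succ) (BFFAux.var 0)
    (fun j => BFFAux.var _)
  convert h2 using 3
  rename_i f z
  exact congrArg (F i f) (Fin.cons_self_tail z).symm
end

section
/- Assume the functional F(f,x⃗,y) is defined from basic feasible functionals G(f,x⃗) and H(f,x⃗,z,y) by polynomially bounded recursion on notation with bound Q: that is, F(f,x⃗,0) = G(f,x⃗), F(f,x⃗,y) = H(f,x⃗,F(f,x⃗,⌊y/2⌋),y) for y > 0, and |F(f,x⃗,y)| ≤ Q(|f|,|x⃗|,|y|) for all f,x⃗,y, where Q is a second-order polynomial. Then F(f,x⃗,y) is a basic feasible functional. -/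
/-- The norm `|f|` of `f : ℕ → ℕ`: `|f|(x) = max { |f(y)| : |y| ≤ x }`. -/
def fnorm (f : ℕ → ℕ) (x : ℕ) : ℕ :=
  (Finset.range (2 ^ x)).sup fun y => Nat.size (f y)

/-- Second-order polynomials in the norms `|f₁|, …, |f_k|` of `k` function variables and
the lengths `|x₁|, …, |x_l|` of `l` number variables. -/
inductive SOPoly (k l : ℕ) : Type
  | const : ℕ → SOPoly k l
  | len : Fin l → SOPoly k l
  | add : SOPoly k l → SOPoly k l → SOPoly k l
  | mul : SOPoly k l → SOPoly k l → SOPoly k l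
  | app : Fin k → SOPoly k l → SOPoly k l

/-- Evaluation of a second-order polynomial at concrete arguments: `|f_i|` is interpreted
as the norm of `f_i` and `|x_j|` as the binary length of `x_j`. -/
def SOPoly.eval {k l : ℕ} (f : Fin k → ℕ → ℕ) (x : Fin l → ℕ) : SOPoly k l → ℕ
  | const n => n
  | len j => Nat.size (x j)
  | add p q => p.eval f x + q.eval f x
  | mul p q => p.eval f x * q.eval f x
  | app i p => fnorm (f i) (p.eval f x)

/-- The depth of a second-order polynomial: the maximal nesting of the applications `|f_i|(·)`. -/
def SOPoly.depth {k l : ℕ} : SOPoly k l → ℕ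
  | const _ => 0
  | len _ => 0
  | add p q => max p.depth q.depth
  | mul p q => max p.depth q.depth
  | app _ p => p.depth + 1

/-! ### Basic closure properties -/

/-- Non-dependent `Fin.snoc`. -/
abbrev sn {n : ℕ} (x : Fin n → ℕ) (a : ℕ) : Fin (n + 1) → ℕ := Fin.snoc (α := fun _ => ℕ) x a

/-- All components of a vector-valued functional are basic feasible. -/
def BV (k m n : ℕ) (X : (Fin k → ℕ → ℕ) → (Fin m → ℕ) → (Fin n → ℕ)) : Prop :=
  ∀ i, BFF k m (fun f x => X f x i)

lemma sn_eta {n : ℕ} (v : Fin (n + 1) → ℕ) : sn (fun i => v i.castSucc) (v (Fin.last n)) = v := by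
  funext i
  refine Fin.lastCases ?_ (fun j => ?_) i <;> simp [sn]

lemma BFF.subst {k m n : ℕ} {H : (Fin k → ℕ → ℕ) → (Fin n → ℕ) → ℕ}
    {X : (Fin k → ℕ → ℕ) → (Fin m → ℕ) → (Fin n → ℕ)} (hH : BFF k n H) (hX : BV k m n X) :
    BFF k m (fun f x => H f (X f x)) := by
  have h1 := BFF.expansion (k' := k) (l' := n + m) id (Fin.castAdd m) Function.injective_id
    (Fin.castAdd_injective n m) hH
  have h2 := BFF.comp h1 hX
  simpa using h2

lemma BFF.var {k m : ℕ} (i : Fin m) : BFF k m (fun _ x => x i) := by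
  have := BFF.expansion (k' := k) (l' := m) Fin.elim0 id (fun a => a.elim0)
    Function.injective_id (BFF.proj m i)
  simpa using this

lemma BV.snoc {k m n : ℕ} {X : (Fin k → ℕ → ℕ) → (Fin m → ℕ) → (Fin n → ℕ)}
    {a : (Fin k → ℕ → ℕ) → (Fin m → ℕ) → ℕ} (hX : BV k m n X) (ha : BFF k m a) :
    BV k m (n + 1) (fun f x => sn (X f x) (a f x)) := by
  intro i
  refine Fin.lastCases ?_ (fun j => ?_) i
  · simpa [sn] using ha
  · simpa [sn] using hX j

lemma BV.vars {k m n : ℕ} (σ : Fin n → Fin m) : BV k m n (fun _ x j => x (σ j)) :=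
  fun i => BFF.var (σ i)

lemma BV.id {k m : ℕ} : BV k m m (fun _ x => x) := fun i => BFF.var i

lemma BFF.lift0 {k m n : ℕ} {H : (Fin n → ℕ) → ℕ} (h : BFF 0 n (fun _ x => H x))
    {X : (Fin k → ℕ → ℕ) → (Fin m → ℕ) → (Fin n → ℕ)} (hX : BV k m n X) :
    BFF k m (fun f x => H (X f x)) :=
  BFF.subst (H := fun _ x => H x) (BFF.expansion (k' := k) (l' := n) Fin.elim0 _root_.id (fun a => a.elim0)
    Function.injective_id h) hX

section closure
variable {k m : ℕ} {a b c d : (Fin k → ℕ → ℕ) → (Fin m → ℕ) → ℕ}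

lemma BV.one (ha : BFF k m a) : BV k m 1 (fun f x => ![a f x]) := by
  intro i; fin_cases i; simpa using ha

lemma BV.two (ha : BFF k m a) (hb : BFF k m b) : BV k m 2 (fun f x => ![a f x, b f x]) := by
  intro i; fin_cases i
  · simpa using ha
  · simpa using hb

lemma BFF.zero' (hm : 0 < m) : BFF k m (fun _ _ => 0) :=
  BFF.lift0 (H := fun _ => 0) BFF.zero (BV.one (BFF.var ⟨0, hm⟩))

lemma BFF.dbl (ha : BFF k m a) : BFF k m (fun f x => 2 * a f x) := by
  simpa using BFF.lift0 (H := fun x => 2 * x 0) BFF.s0 (BV.one ha)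

lemma BFF.dbl1 (ha : BFF k m a) : BFF k m (fun f x => 2 * a f x + 1) := by
  simpa using BFF.lift0 (H := fun x => 2 * x 0 + 1) BFF.s1 (BV.one ha)

lemma BFF.smash' (ha : BFF k m a) (hb : BFF k m b) :
    BFF k m (fun f x => smash (a f x) (b f x)) := by
  simpa using BFF.lift0 (H := fun x => smash (x 0) (x 1)) BFF.smashF (BV.two ha hb)

lemma size_smash (x y : ℕ) : Nat.size (smash x y) = Nat.size x * Nat.size y + 1 := by
  simp [smash, Nat.size_pow]

lemma size_dbl1 (x : ℕ) : Nat.size (2 * x + 1) = Nat.size x + 1 := by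
  have := Nat.size_bit (b := true) (n := x) (by simp)
  simpa [Nat.bit] using this

lemma size_dbl (x : ℕ) (hx : 0 < x) : Nat.size (2 * x) = Nat.size x + 1 := by
  have := Nat.size_bit (b := false) (n := x) (by simp; omega)
  simpa [Nat.bit] using this

lemma size_half (y : ℕ) : Nat.size (y / 2) = Nat.size y - 1 := by
  rcases Nat.eq_zero_or_pos y with rfl | hy
  · simp
  rcases Nat.even_or_odd' y with ⟨z, rfl | rfl⟩
  · rw [size_dbl z (by omega)]; simp
  · rw [size_dbl1 z]
    have : (2 * z + 1) / 2 = z := by omega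
    simp [this]

lemma size_pos_iff (y : ℕ) : 0 < Nat.size y ↔ 0 < y := Nat.size_pos

lemma half_aux : BFF 0 2 (fun _ x => x 1 / 2) := by
  refine BFF.lrn (l := 1) (G := fun _ _ => 0) (H₁ := fun _ x => x 1) (H₂ := fun _ x => x 1)
    (K := fun _ x => x 1) _ (BFF.zero' (by norm_num)) (BFF.var 1) (BFF.var 1) (BFF.var 1) ?_ ?_ ?_ ?_
  · intro f x; simp [Fin.snoc]
  · intro f x y hy; simp [Fin.snoc]
  · intro f x y; simp [Fin.snoc]; omega
  · intro f x; exact Nat.size_le_size (Nat.div_le_self _ _)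

lemma BFF.half (ha : BFF k m a) : BFF k m (fun f x => a f x / 2) := by
  simpa using BFF.lift0 (H := fun x => x 1 / 2) half_aux (BV.two ha ha)

lemma cond_aux : BFF 0 3 (fun _ x => if x 2 = 0 then x 0 else x 1) := by
  refine BFF.lrn (l := 2) (G := fun _ x => x 0) (H₁ := fun _ x => x 1) (H₂ := fun _ x => x 1)
    (K := fun _ x => smash (2 * x 0 + 1) (2 * x 1 + 1)) _ (BFF.var 0) (BFF.var 1) (BFF.var 1)
    (BFF.smash' (BFF.dbl1 (BFF.var 0)) (BFF.dbl1 (BFF.var 1))) ?_ ?_ ?_ ?_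
  · intro f x; simp [Fin.snoc]
  · intro f x y hy; simp [Fin.snoc, hy.ne']
  · intro f x y; simp [Fin.snoc]
  · intro f x
    rw [size_smash, size_dbl1, size_dbl1]
    split_ifs <;> nlinarith [Nat.zero_le (Nat.size (x 0) * Nat.size (x 1))]

lemma BV.three (ha : BFF k m a) (hb : BFF k m b) (hc : BFF k m c) :
    BV k m 3 (fun f x => ![a f x, b f x, c f x]) := by
  intro i; fin_cases i
  · simpa using ha
  · simpa using hb
  · simpa using hc

lemma BFF.cond (hc : BFF k m c) (ha : BFF k m a) (hb : BFF k m b) :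
    BFF k m (fun f x => if c f x = 0 then a f x else b f x) := by
  exact BFF.lift0 (H := fun x => if x 2 = 0 then x 0 else x 1) cond_aux (BV.three ha hb hc)

lemma shift_aux : BFF 0 2 (fun _ x => x 0 / 2 ^ Nat.size (x 1)) := by
  refine BFF.lrn (l := 1) (G := fun _ x => x 0) (H₁ := fun _ x => x 2 / 2) (H₂ := fun _ x => x 2 / 2)
    (K := fun _ x => x 0) _ (BFF.var 0) (BFF.half (BFF.var 2)) (BFF.half (BFF.var 2)) (BFF.var 0)
    ?_ ?_ ?_ ?_
  · intro f x; simp [Fin.snoc]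
  · intro f x y hy; simp [Fin.snoc, size_dbl y hy, Nat.div_div_eq_div_mul, pow_succ]
  · intro f x y; simp [Fin.snoc, size_dbl1, Nat.div_div_eq_div_mul, pow_succ]
  · intro f x; exact Nat.size_le_size (Nat.div_le_self _ _)

lemma BFF.szle (ha : BFF k m a) (hb : BFF k m b) (hc : BFF k m c) (hd : BFF k m d) :
    BFF k m (fun f x => if Nat.size (a f x) ≤ Nat.size (b f x) then c f x else d f x) := by
  have h1 : BFF k m (fun f x => a f x / 2 ^ Nat.size (b f x)) := by
    simpa using BFF.lift0 (H := fun x => x 0 / 2 ^ Nat.size (x 1)) shift_aux (BV.two ha hb)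
  have h2 := BFF.cond h1 hc hd
  refine (congrArg (BFF k m) ?_).mp h2
  funext f x
  have : a f x / 2 ^ Nat.size (b f x) = 0 ↔ Nat.size (a f x) ≤ Nat.size (b f x) := by
    rw [Nat.div_eq_zero_iff, Nat.size_le]
    simp
  simp only [this]

/-- truncation -/
def tr (K a : ℕ) : ℕ := if Nat.size a ≤ Nat.size K then a else 0

lemma size_tr (K a : ℕ) : Nat.size (tr K a) ≤ Nat.size K := by
  unfold tr; split_ifs <;> simp [*]

lemma tr_eq {K a : ℕ} (h : Nat.size a ≤ Nat.size K) : tr K a = a := by simp [tr, h]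

lemma BFF.tr' (hm : 0 < m) (ha : BFF k m a) (hb : BFF k m b) :
    BFF k m (fun f x => tr (a f x) (b f x)) :=
  BFF.szle hb ha hb (BFF.zero' hm)

end closure

lemma BFF.app {m : ℕ} {a : (Fin 1 → ℕ → ℕ) → (Fin m → ℕ) → ℕ} (ha : BFF 1 m a) :
    BFF 1 m (fun f x => f 0 (a f x)) := by
  simpa using BFF.subst BFF.ap (BV.one ha)

/-- plain recursion on notation -/
def rn (g : ℕ) (h : ℕ → ℕ → ℕ) (y : ℕ) : ℕ :=
  if hy : y = 0 then g else h (rn g h (y / 2)) y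
termination_by y
decreasing_by omega

lemma rn_zero (g : ℕ) (h : ℕ → ℕ → ℕ) : rn g h 0 = g := by rw [rn]; simp
lemma rn_pos (g : ℕ) (h : ℕ → ℕ → ℕ) {y : ℕ} (hy : 0 < y) :
    rn g h y = h (rn g h (y / 2)) y := by rw [rn]; simp [hy.ne']

/-- Recursion on notation with truncation. -/
lemma brec {k l : ℕ} {G : (Fin k → ℕ → ℕ) → (Fin l → ℕ) → ℕ}
    {H : (Fin k → ℕ → ℕ) → (Fin (l + 2) → ℕ) → ℕ} {K : (Fin k → ℕ → ℕ) → (Fin (l + 1) → ℕ) → ℕ}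
    (hG : BFF k l G) (hH : BFF k (l + 2) H) (hK : BFF k (l + 1) K)
    (hb : ∀ f x, Nat.size (G f x) ≤ Nat.size (K f (sn x 0))) :
    ∃ Φ, BFF k (l + 1) Φ ∧ (∀ f x, Φ f (sn x 0) = G f x) ∧
      (∀ f x y, 0 < y → Φ f (sn x y) = tr (K f (sn x y)) (H f (sn (sn x (Φ f (sn x (y / 2)))) y))) := by
  let Φ : (Fin k → ℕ → ℕ) → (Fin (l + 1) → ℕ) → ℕ := fun f v =>
    rn (G f (fun i => v i.castSucc)) (fun z y => tr (K f (sn (fun i => v i.castSucc) y))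
      (H f (sn (sn (fun i => v i.castSucc) z) y))) (v (Fin.last l))
  have h0 : ∀ f x, Φ f (sn x 0) = G f x := by
    intro f x; simp [Φ, sn, rn_zero]
  have h1 : ∀ f x y, 0 < y →
      Φ f (sn x y) = tr (K f (sn x y)) (H f (sn (sn x (Φ f (sn x (y / 2)))) y)) := by
    intro f x y hy
    simp only [Φ, sn, Fin.snoc_castSucc, Fin.snoc_last]
    rw [rn_pos _ _ hy]
  refine ⟨Φ, ?_, h0, h1⟩
  have hst : ∀ (a : (Fin k → ℕ → ℕ) → (Fin (l + 2) → ℕ) → ℕ), BFF k (l + 2) a →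
      BFF k (l + 2) (fun f u => tr (K f (sn (fun i : Fin l => u i.castSucc.castSucc) (a f u)))
        (H f (sn (sn (fun i : Fin l => u i.castSucc.castSucc) (u (Fin.last (l + 1)))) (a f u)))) := by
    intro a ha
    exact BFF.tr' (by omega) (BFF.subst hK (BV.snoc (BV.vars _) ha))
      (BFF.subst hH (BV.snoc (BV.snoc (BV.vars _) (BFF.var _)) ha))
  refine BFF.lrn Φ hG (hst _ (BFF.dbl (BFF.var (Fin.last l).castSucc)))
    (hst _ (BFF.dbl1 (BFF.var (Fin.last l).castSucc))) hK h0 ?_ ?_ ?_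
  · intro f x y hy
    have := h1 f x (2 * y) (by omega)
    rw [Nat.mul_div_cancel_left y (by norm_num)] at this
    simp only [sn] at this
    rw [this]; simp [sn]
  · intro f x y
    have := h1 f x (2 * y + 1) (by omega)
    rw [show (2 * y + 1) / 2 = y by omega] at this
    simp only [sn] at this
    rw [this]; simp [sn]
  · intro f v
    rw [← sn_eta v]
    rcases Nat.eq_zero_or_pos (v (Fin.last l)) with h | h
    · rw [h, h0]; exact hb _ _
    · rw [h1 _ _ _ h]; exact size_tr _ _

/-! ### Substitution of a feasible function for the oracle -/

/-- left part of a vector -/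
abbrev lft {p l : ℕ} (v : Fin (p + l) → ℕ) : Fin p → ℕ := fun i => v (Fin.castAdd l i)
/-- right part of a vector -/
abbrev rgt {p l : ℕ} (v : Fin (p + l) → ℕ) : Fin l → ℕ := fun j => v (Fin.natAdd p j)

lemma lft_sn {p l : ℕ} (v : Fin (p + l) → ℕ) (a : ℕ) : lft (l := l + 1) (sn v a) = lft v := by
  funext i
  show sn v a (Fin.castSucc (Fin.castAdd l i)) = _
  simp [sn]

lemma rgt_sn {p l : ℕ} (v : Fin (p + l) → ℕ) (a : ℕ) :
    rgt (l := l + 1) (sn v a) = sn (rgt v) a := by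
  funext i
  refine Fin.lastCases ?_ (fun j => ?_) i
  · show sn v a (Fin.last (p + l)) = _
    simp [sn]
  · have h1 : sn v a (Fin.castSucc (Fin.natAdd p j)) = v (Fin.natAdd p j) :=
      Fin.snoc_castSucc (α := fun _ => ℕ) _ _ _
    have h2 : sn (rgt v) a (Fin.castSucc j) = rgt v j :=
      Fin.snoc_castSucc (α := fun _ => ℕ) _ _ _
    exact h1.trans h2.symm

lemma BV.lft {k p l : ℕ} : BV k (p + l) p (fun _ v => lft v) := BV.vars _
lemma BV.rgt {k p l : ℕ} : BV k (p + l) l (fun _ v => rgt v) := BV.vars _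

lemma BV.append {k m p l : ℕ} {X : (Fin k → ℕ → ℕ) → (Fin m → ℕ) → (Fin p → ℕ)}
    {Y : (Fin k → ℕ → ℕ) → (Fin m → ℕ) → (Fin l → ℕ)} (hX : BV k m p X) (hY : BV k m l Y) :
    BV k m (p + l) (fun f x => Fin.append (X f x) (Y f x)) := by
  intro i
  refine Fin.addCases (fun j => ?_) (fun j => ?_) i
  · simpa using hX j
  · simpa using hY j

lemma lft_append {p l : ℕ} (w : Fin p → ℕ) (x : Fin l → ℕ) : lft (Fin.append w x) = w := by
  funext i; simp
lemma rgt_append {p l : ℕ} (w : Fin p → ℕ) (x : Fin l → ℕ) : rgt (Fin.append w x) = x := by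
  funext i; simp
lemma append_eta {p l : ℕ} (v : Fin (p + l) → ℕ) : Fin.append (lft v) (rgt v) = v := by
  funext i
  refine Fin.addCases (fun j => ?_) (fun j => ?_) i <;> simp

lemma BFF.substFun {k l : ℕ} {G : (Fin k → ℕ → ℕ) → (Fin l → ℕ) → ℕ} (hG : BFF k l G) {p : ℕ}
    {T : (Fin 1 → ℕ → ℕ) → (Fin (p + 1) → ℕ) → ℕ} (hT : BFF 1 (p + 1) T) :
    BFF 1 (p + l) (fun f v => G (fun _ a => T f (sn (lft v) a)) (rgt v)) := by
  induction hG with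
  | zero => exact BFF.zero' (by omega)
  | s0 => exact BFF.dbl (BFF.var _)
  | s1 => exact BFF.dbl1 (BFF.var _)
  | proj n i => exact BFF.var _
  | smashF => exact BFF.smash' (BFF.var _) (BFF.var _)
  | ap => exact BFF.subst hT (BV.snoc BV.lft (BFF.var _))
  | expansion ρ σ hρ hσ hG ih =>
    have := BFF.subst ih (BV.append (k := 1) (BV.lft (p := p)) (BV.vars (fun j => Fin.natAdd p (σ j))))
    simpa only [lft_append, rgt_append] using this
  | @comp k l m H G hH hG ihH ihG =>
    have := BFF.subst ihH (BV.append (k := 1) (BV.lft (p := p)) (BV.append (fun i => ihG i) BV.rgt))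
    simpa only [lft_append, rgt_append] using this
  | @lrn k l F G H₁ H₂ K hG hH₁ hH₂ hK hbase heven hodd hbound ihG ih1 ih2 ihK =>
    refine BFF.lrn (l := p + l) _ ihG ih1 ih2 ihK ?_ ?_ ?_ ?_
    · intro f x
      have h1 := lft_sn x 0
      have h2 := rgt_sn x 0
      simp only [sn] at h1 h2 ⊢
      rw [h1, h2, hbase]
    · intro f x y hy
      have h1 := fun a => lft_sn x a
      have h2 := fun a => rgt_sn x a
      have h3 := fun x a => lft_sn (p := p) (l := l + 1) x a
      have h4 := fun x a => rgt_sn (p := p) (l := l + 1) x a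
      simp only [sn] at h1 h2 h3 h4 ⊢
      rw [h1, h2, heven _ _ _ hy, h3, h4, h1, h2]
    · intro f x y
      have h1 := fun a => lft_sn x a
      have h2 := fun a => rgt_sn x a
      have h3 := fun x a => lft_sn (p := p) (l := l + 1) x a
      have h4 := fun x a => rgt_sn (p := p) (l := l + 1) x a
      simp only [sn] at h1 h2 h3 h4 ⊢
      rw [h1, h2, hodd, h3, h4, h1, h2]
    · intro f x
      exact hbound _ _

/-! ### Finding violated queries -/

section finder
variable {n : ℕ} {W : (Fin 1 → ℕ → ℕ) → (Fin n → ℕ) → ℕ → ℕ}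

lemma BFF.subW (hW : BFF 1 (n + 1) (fun f u => W f (fun i => u i.castSucc) (u (Fin.last n))))
    {m : ℕ} {X : (Fin 1 → ℕ → ℕ) → (Fin m → ℕ) → (Fin n → ℕ)} (hX : BV 1 m n X)
    {a : (Fin 1 → ℕ → ℕ) → (Fin m → ℕ) → ℕ} (ha : BFF 1 m a) :
    BFF 1 m (fun f x => W f (X f x) (a f x)) := by
  simpa [sn] using BFF.subst hW (BV.snoc hX ha)

lemma join (hW : BFF 1 (n + 1) (fun f u => W f (fun i => u i.castSucc) (u (Fin.last n))))
    {D E : (Fin 1 → ℕ → ℕ) → (Fin n → ℕ) → ℕ} (hD : BFF 1 n D) (hE : BFF 1 n E) :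
    ∃ J, BFF 1 n J ∧ ∀ f v, W f v (J f v) = 0 → W f v (D f v) = 0 ∧ W f v (E f v) = 0 := by
  refine ⟨_, BFF.cond (BFF.subW hW BV.id hD) hE hD, ?_⟩
  intro f v h
  split_ifs at h with h1 <;> simp_all

lemma joinAll (hW : BFF 1 (n + 1) (fun f u => W f (fun i => u i.castSucc) (u (Fin.last n)))) {m : ℕ}
    {D : Fin m → (Fin 1 → ℕ → ℕ) → (Fin n → ℕ) → ℕ}
    {E : (Fin 1 → ℕ → ℕ) → (Fin n → ℕ) → ℕ} (hD : ∀ i, BFF 1 n (D i)) (hE : BFF 1 n E) :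
    ∃ J, BFF 1 n J ∧ ∀ f v, W f v (J f v) = 0 → (∀ i, W f v (D i f v) = 0) ∧ W f v (E f v) = 0 := by
  induction m with
  | zero => exact ⟨E, hE, fun f v h => ⟨fun i => i.elim0, h⟩⟩
  | succ m ih =>
    obtain ⟨J, hJ, hJ'⟩ := ih (D := fun i => D i.castSucc) (fun i => hD _)
    obtain ⟨J2, hJ2, hJ2'⟩ := join hW (hD (Fin.last m)) hJ
    refine ⟨J2, hJ2, fun f v h => ?_⟩
    obtain ⟨h1, h2⟩ := hJ2' f v h
    obtain ⟨h3, h4⟩ := hJ' f v h2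
    exact ⟨fun i => Fin.lastCases h1 h3 i, h4⟩

lemma joinRec (hn : 0 < n)
    (hW : BFF 1 (n + 1) (fun f u => W f (fun i => u i.castSucc) (u (Fin.last n))))
    {D : (Fin 1 → ℕ → ℕ) → (Fin n → ℕ) → ℕ} {E : (Fin 1 → ℕ → ℕ) → (Fin (n + 1) → ℕ) → ℕ}
    (hD : BFF 1 n D) (hE : BFF 1 (n + 1) E) :
    ∃ J, BFF 1 (n + 1) J ∧ ∀ f v y, W f v (J f (sn v y)) = 0 → W f v (D f v) = 0 ∧
      ∀ i, 0 < y / 2 ^ i → W f v (E f (sn v (y / 2 ^ i))) = 0 := by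
  -- the location of the first violation
  have hH : BFF 1 (n + 2) (fun f u =>
      if W f (fun i => u i.castSucc.castSucc)
        (E f (sn (fun i : Fin n => u i.castSucc.castSucc) (u (Fin.last n).castSucc))) = 0
      then u (Fin.last (n + 1)) else u (Fin.last n).castSucc) :=
    BFF.cond (BFF.subW hW (BV.vars _) (BFF.subst hE (BV.snoc (BV.vars _) (BFF.var _))))
      (BFF.var _) (BFF.var _)
  obtain ⟨Φ, hΦ, h0, h1⟩ := brec (BFF.zero' (k := 1) hn) hH (BFF.var (Fin.last n)) (by simp)
  have hsz : ∀ f v y, Nat.size (Φ f (sn v y)) ≤ Nat.size y := by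
    intro f v y
    rcases Nat.eq_zero_or_pos y with rfl | hy
    · rw [h0]
    · rw [h1 _ _ _ hy]
      refine (size_tr _ _).trans ?_
      simp [sn]
  have h2 : ∀ f v y, 0 < y → Φ f (sn v y) =
      if W f v (E f (sn v (Φ f (sn v (y / 2))))) = 0 then y else Φ f (sn v (y / 2)) := by
    intro f v y hy
    rw [h1 _ _ _ hy, tr_eq]
    · simp [sn]
    · simp only [sn, Fin.snoc_castSucc, Fin.snoc_last]
      split_ifs
      · exact le_rfl
      · exact (hsz f v (y / 2)).trans (Nat.size_le_size (Nat.div_le_self _ _))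
  have hbig : BFF 1 (n + 1 + 1) (fun f u => W f (fun i => u i.castSucc.castSucc) (u (Fin.last (n + 1)))) :=
    BFF.subW hW (BV.vars _) (BFF.var _)
  have hDb : BFF 1 (n + 1) (fun f u => D f (fun i => u i.castSucc)) := BFF.subst hD (BV.vars _)
  have hEb : BFF 1 (n + 1) (fun f u => E f (sn (fun i => u i.castSucc) (Φ f u))) :=
    BFF.subst hE (BV.snoc (BV.vars _) hΦ)
  obtain ⟨J, hJ, hJ'⟩ := join (n := n + 1) (W := fun f u a => W f (fun i => u i.castSucc) a) hbig hDb hEb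
  refine ⟨J, hJ, fun f v y h => ?_⟩
  have h3 := hJ' f (sn v y) (by simpa [sn] using h)
  simp only [sn, Fin.snoc_castSucc] at h3
  refine ⟨h3.1, ?_⟩
  have h4 := h3.2
  clear h3 h
  induction y using Nat.strong_induction_on with
  | _ y ih =>
    rcases Nat.eq_zero_or_pos y with rfl | hy
    · intro i hi; simp at hi
    have h5 := h2 f v y hy
    simp only [sn] at h5
    split_ifs at h5 with h6
    · intro i hi
      cases i with
      | zero => rw [h5] at h4; simpa using h4
      | succ i =>
        have := ih (y / 2) (by omega) h6 i
        rw [Nat.div_div_eq_div_mul, ← pow_succ'] at this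
        exact this hi
    · rw [h5] at h4; exact absurd h4 h6

end finder

/-- The truncated oracle. -/
def trunc (V : ℕ → ℕ) (f : ℕ → ℕ) (a : ℕ) : ℕ := if V a = 0 then f a else 0

lemma rec_induct {P : ℕ → Prop} {ok : ℕ → Prop} (h0 : P 0)
    (h1 : ∀ y, 0 < y → ok y → P (y / 2) → P y) (y : ℕ) (h : ∀ i, 0 < y / 2 ^ i → ok (y / 2 ^ i)) :
    P y := by
  induction y using Nat.strong_induction_on with
  | _ y ih =>
    rcases Nat.eq_zero_or_pos y with rfl | hy
    · exact h0
    · refine h1 y hy (by simpa using h 0 (by simpa using hy)) (ih _ (by omega) fun i hi => ?_)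
      have := h (i + 1)
      rw [pow_succ', ← Nat.div_div_eq_div_mul] at this
      exact this hi

lemma finder {k l : ℕ} {G : (Fin k → ℕ → ℕ) → (Fin l → ℕ) → ℕ} (hG : BFF k l G) {p : ℕ}
    (hp : 0 < p) {V : (Fin 1 → ℕ → ℕ) → (Fin (p + 1) → ℕ) → ℕ} (hV : BFF 1 (p + 1) V) :
    ∃ D, BFF 1 (p + l) D ∧ ∀ f v, V f (sn (lft v) (D f v)) = 0 →
      G (fun _ => f 0) (rgt v) = G (fun _ => trunc (fun a => V f (sn (lft v) a)) (f 0)) (rgt v) := by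
  have hT : BFF 1 (p + 1) (fun f u => if V f u = 0 then f 0 (u (Fin.last p)) else 0) :=
    BFF.cond hV (BFF.app (BFF.var _)) (BFF.zero' (by omega))
  have hsub : ∀ {k l : ℕ} {G : (Fin k → ℕ → ℕ) → (Fin l → ℕ) → ℕ}, BFF k l G →
      BFF 1 (p + l) (fun f v => G (fun _ => trunc (fun a => V f (sn (lft v) a)) (f 0)) (rgt v)) := by
    intro k l G hG
    have := hG.substFun hT
    simp only [sn, Fin.snoc_last] at this
    exact this
  have hW : ∀ l, BFF 1 (p + l + 1) (fun f u =>
      (fun f v a => V f (sn (lft v) a)) f (fun i => u i.castSucc) (u (Fin.last (p + l)))) := by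
    intro l
    exact BFF.subst hV (BV.snoc (BV.vars _) (BFF.var _))
  have z : ∀ l, BFF 1 (p + l) (fun _ _ => 0) := fun l => BFF.zero' (by omega)
  induction hG with
  | zero => exact ⟨_, z _, fun _ _ _ => rfl⟩
  | s0 => exact ⟨_, z _, fun _ _ _ => rfl⟩
  | s1 => exact ⟨_, z _, fun _ _ _ => rfl⟩
  | proj n i => exact ⟨_, z _, fun _ _ _ => rfl⟩
  | smashF => exact ⟨_, z _, fun _ _ _ => rfl⟩
  | ap =>
    refine ⟨_, BFF.var (Fin.natAdd p 0), fun f v h => ?_⟩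
    simp only [trunc]
    rw [if_pos h]
  | expansion ρ σ hρ hσ hG ih =>
    obtain ⟨D, hD, h⟩ := ih
    refine ⟨_, BFF.subst hD (BV.append (BV.lft (p := p)) (BV.vars (fun j => Fin.natAdd p (σ j)))),
      fun f v h' => ?_⟩
    have := h f (Fin.append (lft v) (fun j => v (Fin.natAdd p (σ j))))
    simp only [lft_append, rgt_append] at this
    exact this h'
  | @comp k l m H G hH hG ihH ihG =>
    choose D hD h using ihG
    obtain ⟨E, hE, h'⟩ := ihH
    have hE' := BFF.subst hE (BV.append (k := 1) (BV.lft (p := p))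
      (BV.append (fun i => hsub (hG i)) BV.rgt))
    obtain ⟨J, hJ, hJ'⟩ := joinAll (W := fun f v a => V f (sn (lft v) a)) (hW l) hD hE'
    refine ⟨J, hJ, fun f v hv => ?_⟩
    obtain ⟨h1, h2⟩ := hJ' f v hv
    have h3 := h' f _ (by rw [lft_append]; exact h2)
    simp only [lft_append, rgt_append] at h3
    beta_reduce
    rw [← h3]
    congr 2
    funext i
    exact h i f v (h1 i)
  | @lrn k l F G H₁ H₂ K hG hH₁ hH₂ hK hbase heven hodd hbound ihG ih1 ih2 ihK =>
    have hF := hsub (BFF.lrn F hG hH₁ hH₂ hK hbase heven hodd hbound)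
    obtain ⟨DG, hDG, hG'⟩ := ihG
    obtain ⟨D1, hD1, h1'⟩ := ih1
    obtain ⟨D2, hD2, h2'⟩ := ih2
    have hX : BV 1 (p + l + 1) (p + l + 1) (fun _ u => sn (fun i : Fin (p + l) => u i.castSucc)
        (u (Fin.last (p + l)) / 2)) := BV.snoc (BV.vars _) (BFF.half (BFF.var _))
    have hY := BV.snoc hX (BFF.subst hF hX)
    have hWs : BFF 1 (p + l + 1 + 1) (fun f u =>
      (fun f (v : Fin (p + l + 1) → ℕ) a => V f (sn (lft (l := l + 1) v) a)) f
        (fun i => u i.castSucc) (u (Fin.last (p + l + 1)))) := hW (l + 1)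
    obtain ⟨E, hE, hE'⟩ := join (W := fun f (v : Fin (p + l + 1) → ℕ) a => V f (sn (lft (l := l + 1) v) a)) hWs (BFF.subst hD1 hY) (BFF.subst hD2 hY)
    obtain ⟨J, hJ, hJ'⟩ := joinRec (W := fun f v a => V f (sn (lft v) a)) (by omega) (hW l) hDG hE
    refine ⟨J, hJ, fun f u hu => ?_⟩
    obtain ⟨v, y, rfl⟩ : ∃ v y, u = sn (n := p + l) v y := ⟨_, _, (sn_eta u).symm⟩
    have e1 := fun a => lft_sn v a
    have e2 := fun a => rgt_sn v a
    have e3 := fun x a => lft_sn (p := p) (l := l + 1) x a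
    have e4 := fun x a => rgt_sn (p := p) (l := l + 1) x a
    rw [lft_sn] at hu
    rw [lft_sn, rgt_sn]
    obtain ⟨j0, j1⟩ := hJ' f v y hu
    generalize hg : trunc (fun a => V f (sn (lft v) a)) (f 0) = g
    have hb0 := hG' f v j0
    rw [hg] at hb0
    refine rec_induct (P := fun y => F (fun _ => f 0) (sn (rgt v) y) = F (fun _ => g) (sn (rgt v) y))
      (ok := fun y => V f (sn (lft v) (E f (sn v y))) = 0) ?_ ?_ y j1
    · have a1 := hbase (fun _ => f 0) (rgt v)
      have a2 := hbase (fun _ => g) (rgt v)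
      simp only [sn]
      rw [a1, a2, hb0]
    · intro y hy hok hP
      have := hE' f (sn v y) (by simpa only [e1] using hok)
      obtain ⟨k1, k2⟩ := this
      have e5 : (fun i => sn v y (Fin.castSucc i)) = v := by funext i; simp [sn]
      have e6 : sn v y (Fin.last (p + l)) = y := by simp [sn]
      simp only [e5, e6, e1, e2, hg] at k1 k2
      have m1 := h1' f (sn (n := p + l + 1) (sn v (y / 2)) (F (fun _ => g) (sn (rgt v) (y / 2)))) (by
        rw [e3, e1]; exact k1)
      have m2 := h2' f (sn (n := p + l + 1) (sn v (y / 2)) (F (fun _ => g) (sn (rgt v) (y / 2)))) (by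
        rw [e3, e1]; exact k2)
      simp only [e1, e2, e3, e4, hg] at m1 m2
      simp only [sn] at m1 m2 hP ⊢
      rcases Nat.even_or_odd' y with ⟨z, rfl | rfl⟩
      · rw [Nat.mul_div_cancel_left z (by norm_num)] at m1 hP
        rw [heven _ _ _ (by omega), heven _ _ _ (by omega), hP, m1]
      · rw [show (2 * z + 1) / 2 = z by omega] at m2 hP
        rw [hodd, hodd, hP, m2]

/-! ### Iteration up to a fixed point -/

lemma iter_bff {n : ℕ} {S : (Fin 1 → ℕ → ℕ) → (Fin (n + 1) → ℕ) → ℕ}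
    {K : (Fin 1 → ℕ → ℕ) → (Fin (n + 1) → ℕ) → ℕ} (hS : BFF 1 (n + 1) S) (hK : BFF 1 (n + 1) K)
    (hb : ∀ f w b i, Nat.size ((fun z => S f (sn w z))^[i] b) ≤ Nat.size (K f (sn w b))) :
    BFF 1 (n + 2) (fun f u => (fun z => S f (sn (fun i : Fin n => u i.castSucc.castSucc) z))^[
      Nat.size (u (Fin.last (n + 1)))] (u (Fin.last n).castSucc)) := by
  have hH : BFF 1 (n + 1 + 2) (fun f u => S f (sn (fun i : Fin n => u i.castSucc.castSucc.castSucc)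
      (u (Fin.last (n + 1)).castSucc))) := BFF.subst hS (BV.snoc (BV.vars _) (BFF.var _))
  have hK' : BFF 1 (n + 1 + 1) (fun f u => K f (fun i => u i.castSucc)) := BFF.subst hK (BV.vars _)
  obtain ⟨Φ, hΦ, h0, h1⟩ := brec (BFF.var (Fin.last n)) hH hK' (by
    intro f x
    have := hb f (fun i => x i.castSucc) (x (Fin.last n)) 0
    simpa [sn_eta, sn] using this)
  refine (congrArg (BFF 1 (n + 2)) ?_).mp hΦ
  funext f u
  obtain ⟨v, y, rfl⟩ : ∃ v y, u = sn (n := n + 1) v y := ⟨_, _, (sn_eta u).symm⟩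
  obtain ⟨w, b, rfl⟩ : ∃ w b, v = sn (n := n) w b := ⟨_, _, (sn_eta v).symm⟩
  simp only [sn, Fin.snoc_castSucc, Fin.snoc_last]
  induction y using Nat.strong_induction_on with
  | _ y ih =>
    rcases Nat.eq_zero_or_pos y with rfl | hy
    · have := h0 f (sn w b)
      simp only [sn, Fin.snoc_last] at this
      rw [this]; simp
    · have h2 := h1 f (sn w b) y hy
      simp only [sn, Fin.snoc_last, Fin.snoc_castSucc] at h2
      rw [ih (y / 2) (by omega), size_half] at h2
      have h3 : Nat.size y = (Nat.size y - 1) + 1 := by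
        have := Nat.size_pos.2 hy
        omega
      have h4 := hb f w b (Nat.size y)
      rw [h3, Function.iterate_succ_apply'] at h4 ⊢
      simp only [sn] at h4
      rw [h2, tr_eq]
      exact h4

lemma fix_count {S : ℕ → ℕ} {μ : ℕ → ℕ} {M : ℕ}
    (hS : ∀ b, S b = b ∨ (Nat.size (S b) ≤ M ∧ μ b < μ (S b))) :
    S ((fun z => S^[μ z + 1] z)^[M] 0) = (fun z => S^[μ z + 1] z)^[M] 0 := by
  have hfix : ∀ i j, i ≤ j → S (S^[i] 0) = S^[i] 0 → S (S^[j] 0) = S^[j] 0 := by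
    intro i j hij h
    obtain ⟨t, rfl⟩ := Nat.exists_eq_add_of_le hij
    induction t with
    | zero => exact h
    | succ t ih =>
      have := ih (by omega)
      rw [← add_assoc, Function.iterate_succ_apply', this, this]
  have hmono : ∀ k, S (S^[k] 0) ≠ S^[k] 0 → ∀ i j, i < j → j ≤ k + 1 → μ (S^[i] 0) < μ (S^[j] 0) := by
    intro k hk i j hij hj
    induction j with
    | zero => omega
    | succ j ih =>
      have h1 : μ (S^[j] 0) < μ (S^[j + 1] 0) := by
        rw [Function.iterate_succ_apply']
        rcases hS (S^[j] 0) with h | h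
        · exact absurd (hfix j k (by omega) h) hk
        · exact h.2
      rcases Nat.lt_succ_iff_lt_or_eq.1 hij with h | h
      · exact (ih h (by omega)).trans h1
      · subst h; exact h1
  have hge : ∀ k, S (S^[k] 0) ≠ S^[k] 0 → k ≤ μ (S^[k] 0) := by
    intro k hk
    have : ∀ j, j ≤ k → j ≤ μ (S^[j] 0) := by
      intro j
      induction j with
      | zero => intro _; omega
      | succ j ih =>
        intro hj
        have := hmono k hk j (j + 1) (by omega) (by omega)
        have := ih (by omega)
        omega
    exact this k le_rfl
  have hN : ∀ N, ∃ k, (fun z => S^[μ z + 1] z)^[N] 0 = S^[k] 0 ∧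
      (S (S^[k] 0) ≠ S^[k] 0 → 2 ^ N ≤ k + 1) := by
    intro N
    induction N with
    | zero => exact ⟨0, rfl, fun _ => by simp⟩
    | succ N ih =>
      obtain ⟨k, h1, h2⟩ := ih
      refine ⟨μ (S^[k] 0) + 1 + k, ?_, ?_⟩
      · rw [Function.iterate_succ_apply', h1, Function.iterate_add_apply S (μ (S^[k] 0) + 1) k]
      · intro h
        have h3 : S (S^[k] 0) ≠ S^[k] 0 := fun h' => h (hfix k _ (by omega) h')
        have := h2 h3
        have := hge k h3
        rw [pow_succ]; omega
  obtain ⟨k, h1, h2⟩ := hN M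
  rw [h1]
  by_contra hk
  have h3 := h2 hk
  have hlt : ∀ i, i ≤ k + 1 → S^[i] 0 < 2 ^ M := by
    intro i hi
    cases i with
    | zero => simp
    | succ i =>
      rw [Function.iterate_succ_apply', ← Nat.size_le]
      rcases hS (S^[i] 0) with h | h
      · exact absurd (hfix i k (by omega) h) hk
      · exact h.1
  have hinj : Set.InjOn (fun i => S^[i] 0) (Finset.range (k + 2) : Set ℕ) := by
    intro i hi j hj hij
    simp only [Finset.coe_range, Set.mem_Iio] at hi hj
    by_contra hne
    rcases Nat.lt_or_gt_of_ne hne with h | h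
    · have := hmono k hk i j h (by omega)
      simp only at hij
      rw [hij] at this; omega
    · have := hmono k hk j i h (by omega)
      simp only at hij
      rw [hij] at this; omega
  have := Finset.card_le_card_of_injOn (s := Finset.range (k + 2)) (t := Finset.range (2 ^ M))
    (fun i => S^[i] 0) (by
      intro i hi
      simp only [Finset.coe_range, Set.mem_Iio] at hi ⊢
      exact hlt i (by omega)) hinj
  simp only [Finset.card_range] at this
  omega

lemma fixpoint {n : ℕ} (hn : 0 < n) {S : (Fin 1 → ℕ → ℕ) → (Fin (n + 1) → ℕ) → ℕ}
    {M : (Fin 1 → ℕ → ℕ) → (Fin n → ℕ) → ℕ} (hS : BFF 1 (n + 1) S) (hM : BFF 1 n M)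
    (h : ∀ f w b, S f (sn w b) = b ∨ (Nat.size (S f (sn w b)) ≤ Nat.size (M f w) ∧
      Nat.size (f 0 b) < Nat.size (f 0 (S f (sn w b))))) :
    ∃ B, BFF 1 n B ∧ ∀ f w, S f (sn w (B f w)) = B f w := by
  have hK : BFF 1 (n + 1) (fun f u => smash (2 * M f (fun i => u i.castSucc) + 1)
      (2 * u (Fin.last n) + 1)) :=
    BFF.smash' (BFF.dbl1 (BFF.subst hM (BV.vars _))) (BFF.dbl1 (BFF.var _))
  have key : ∀ f w b i, (fun z => S f (sn w z))^[i] b = b ∨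
      Nat.size ((fun z => S f (sn w z))^[i] b) ≤ Nat.size (M f w) := by
    intro f w b i
    induction i with
    | zero => exact Or.inl rfl
    | succ i ih =>
      rw [Function.iterate_succ_apply']
      rcases h f w ((fun z => S f (sn w z))^[i] b) with h1 | h1
      · rw [h1]; exact ih
      · exact Or.inr h1.1
  have bd : ∀ (f : Fin 1 → ℕ → ℕ) (w : Fin n → ℕ) b z, (z = b ∨ Nat.size z ≤ Nat.size (M f w)) →
      Nat.size z ≤ Nat.size (smash (2 * M f (fun i => sn w b i.castSucc) + 1)
        (2 * sn w b (Fin.last n) + 1)) := by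
    intro f w b z hz
    rw [size_smash, size_dbl1, size_dbl1]
    simp only [sn, Fin.snoc_castSucc, Fin.snoc_last]
    rcases hz with rfl | hz
    · nlinarith [Nat.zero_le (Nat.size (M f w) * Nat.size z)]
    · nlinarith [Nat.zero_le (Nat.size (M f w) * Nat.size b)]
  have hI := iter_bff hS hK (fun f w b i => bd f w b _ (key f w b i))
  have hE : BFF 1 (n + 1) (fun f u => (fun z => S f (sn (fun i : Fin n => u i.castSucc) z))^[
      Nat.size (f 0 (u (Fin.last n))) + 1] (u (Fin.last n))) := by
    have := BFF.subst hI (BV.snoc BV.id (BFF.dbl1 (BFF.app (BFF.var (Fin.last n)))))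
    simpa only [sn, Fin.snoc_castSucc, Fin.snoc_last, size_dbl1] using this
  have key2 : ∀ f w b i, (fun z => (fun z => S f (sn w z))^[Nat.size (f 0 z) + 1] z)^[i] b = b ∨
      Nat.size ((fun z => (fun z => S f (sn w z))^[Nat.size (f 0 z) + 1] z)^[i] b)
        ≤ Nat.size (M f w) := by
    intro f w b i
    induction i with
    | zero => exact Or.inl rfl
    | succ i ih =>
      rw [Function.iterate_succ_apply']
      rcases key f w ((fun z => (fun z => S f (sn w z))^[Nat.size (f 0 z) + 1] z)^[i] b)
        (Nat.size (f 0 ((fun z => (fun z => S f (sn w z))^[Nat.size (f 0 z) + 1] z)^[i] b)) + 1) with h1 | h1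
      · rw [h1]; exact ih
      · exact Or.inr h1
  have hO := iter_bff hE hK (fun f w b i => bd f w b _ (by
    simpa only [sn, Fin.snoc_castSucc, Fin.snoc_last] using key2 f w b i))
  have hB := BFF.subst hO (BV.snoc (BV.snoc BV.id (BFF.zero' hn)) hM)
  simp only [sn, Fin.snoc_castSucc, Fin.snoc_last] at hB
  refine ⟨_, hB, fun f w => ?_⟩
  exact fix_count (S := fun z => S f (sn w z)) (μ := fun z => Nat.size (f 0 z))
    (M := Nat.size (M f w)) (h f w)

/-! ### Bounding second-order polynomials -/

/-- one level of growth -/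
def stp (r s : ℕ) : ℕ := (r * (s + 1) + 1) * (r * (s + 1) + 1) + 1

/-- iterated growth -/
def Rseq (g : ℕ → ℕ) (r : ℕ) : ℕ → ℕ
  | 0 => r
  | j + 1 => stp (Rseq g r j) (fnorm g (Rseq g r j))

lemma stp_mono {r r' s s' : ℕ} (h : r ≤ r') (h' : s ≤ s') : stp r s ≤ stp r' s' := by
  unfold stp; gcongr

lemma stp_ge (r s : ℕ) : r * r + 1 ≤ stp r s := by
  unfold stp
  have : r ≤ r * (s + 1) + 1 := by nlinarith [Nat.zero_le (r * s)]
  have := Nat.mul_le_mul this this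
  omega

lemma stp_ge_right {r s : ℕ} (hr : 0 < r) : s ≤ stp r s := by
  unfold stp
  have : s ≤ r * (s + 1) + 1 := by nlinarith [Nat.mul_le_mul_right (s + 1) hr]
  nlinarith

lemma stp_gt (r s : ℕ) : r < stp r s := by
  have := stp_ge r s
  have : r ≤ r * r := Nat.le_mul_self r
  omega

lemma Rseq_mono (g : ℕ → ℕ) (r : ℕ) : StrictMono (Rseq g r) :=
  strictMono_nat_of_lt_succ fun _ => stp_gt _ _

lemma fnorm_mono (g : ℕ → ℕ) {a b : ℕ} (h : a ≤ b) : fnorm g a ≤ fnorm g b := by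
  unfold fnorm
  apply Finset.sup_mono
  intro i hi
  simp only [Finset.mem_range] at *
  exact hi.trans_le (Nat.pow_le_pow_right (by norm_num) h)

lemma poly_bound {n : ℕ} (Q : SOPoly 1 n) : ∃ d, ∀ (f : Fin 1 → ℕ → ℕ) (x : Fin n → ℕ) (r : ℕ),
    2 ≤ r → (∀ i, Nat.size (x i) ≤ r) → Q.eval f x ≤ Rseq (f 0) r d := by
  induction Q with
  | const c =>
    refine ⟨c, fun f x r hr hx => ?_⟩
    exact (Rseq_mono (f 0) r).id_le c
  | len j => exact ⟨0, fun f x r hr hx => hx j⟩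
  | add p q ihp ihq =>
    obtain ⟨d, hd⟩ := ihp
    obtain ⟨e, he⟩ := ihq
    refine ⟨max d e + 1, fun f x r hr hx => ?_⟩
    have h1 := (hd f x r hr hx).trans ((Rseq_mono (f 0) r).monotone (le_max_left d e))
    have h2 := (he f x r hr hx).trans ((Rseq_mono (f 0) r).monotone (le_max_right d e))
    have h3 : r ≤ Rseq (f 0) r (max d e) := (Rseq_mono (f 0) r).monotone (Nat.zero_le _)
    have h4 := stp_ge (Rseq (f 0) r (max d e)) (fnorm (f 0) (Rseq (f 0) r (max d e)))
    simp only [SOPoly.eval, Rseq]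
    nlinarith
  | mul p q ihp ihq =>
    obtain ⟨d, hd⟩ := ihp
    obtain ⟨e, he⟩ := ihq
    refine ⟨max d e + 1, fun f x r hr hx => ?_⟩
    have h1 := (hd f x r hr hx).trans ((Rseq_mono (f 0) r).monotone (le_max_left d e))
    have h2 := (he f x r hr hx).trans ((Rseq_mono (f 0) r).monotone (le_max_right d e))
    have h4 := stp_ge (Rseq (f 0) r (max d e)) (fnorm (f 0) (Rseq (f 0) r (max d e)))
    have h5 := Nat.mul_le_mul h1 h2
    simp only [SOPoly.eval, Rseq]
    omega
  | app i p ih =>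
    obtain ⟨d, hd⟩ := ih
    refine ⟨d + 1, fun f x r hr hx => ?_⟩
    have h1 := fnorm_mono (f 0) (hd f x r hr hx)
    have h3 : r ≤ Rseq (f 0) r d := (Rseq_mono (f 0) r).monotone (Nat.zero_le _)
    simp only [SOPoly.eval, Rseq]
    rw [Subsingleton.elim i 0]
    exact h1.trans (stp_ge_right (by omega))

lemma exists_max (l : ℕ) : ∃ M : (Fin (l + 1) → ℕ) → ℕ, BFF 1 (l + 1) (fun _ u => M u) ∧
    ∀ u, 2 ≤ Nat.size (M u) ∧ ∀ i, Nat.size (u i) ≤ Nat.size (M u) := by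
  induction l with
  | zero =>
    refine ⟨fun u => smash (2 * u 0 + 1) (2 * u 0 + 1),
      BFF.smash' (BFF.dbl1 (BFF.var 0)) (BFF.dbl1 (BFF.var 0)), fun u => ?_⟩
    rw [size_smash, size_dbl1]
    refine ⟨by nlinarith [Nat.zero_le (Nat.size (u 0))], fun i => ?_⟩
    rw [show i = 0 from Subsingleton.elim (α := Fin 1) i 0]
    nlinarith [Nat.zero_le (Nat.size (u 0))]
  | succ l ih =>
    obtain ⟨M, hM, h⟩ := ih
    refine ⟨fun u => smash (2 * M (fun i => u i.castSucc) + 1) (2 * u (Fin.last (l + 1)) + 1),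
      BFF.smash' (BFF.dbl1 (BFF.subst hM (BV.vars Fin.castSucc))) (BFF.dbl1 (BFF.var _)), fun u => ?_⟩
    obtain ⟨h1, h2⟩ := h (fun i => u i.castSucc)
    rw [size_smash, size_dbl1, size_dbl1]
    generalize Nat.size (M fun i => u i.castSucc) = a at *
    refine ⟨by nlinarith [Nat.zero_le (a * Nat.size (u (Fin.last (l + 1))))], fun i => ?_⟩
    refine Fin.lastCases ?_ (fun j => ?_) i
    · nlinarith [Nat.zero_le (a * Nat.size (u (Fin.last (l + 1))))]
    · have := h2 j
      nlinarith [Nat.zero_le (a * Nat.size (u (Fin.last (l + 1))))]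

/-! ### The levels -/

/-- `rho`: a number whose length bounds the `j`-th level. -/
def rho {n : ℕ} (M : (Fin n → ℕ) → ℕ) (f : Fin 1 → ℕ → ℕ) : (j : ℕ) → (Fin (n + j) → ℕ) → ℕ
  | 0, w => M w
  | j + 1, w =>
    let t := smash (rho M f j (fun i => w i.castSucc)) (2 * f 0 (w (Fin.last (n + j))) + 1)
    smash t t

/-- violation of one of the first `j` caps -/
def vio {n : ℕ} (M : (Fin n → ℕ) → ℕ) (f : Fin 1 → ℕ → ℕ) : (j : ℕ) → (Fin (n + j) → ℕ) → ℕ → ℕ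
  | 0, _, _ => 0
  | j + 1, w, a =>
    if Nat.size (f 0 a) ≤ Nat.size (f 0 (w (Fin.last (n + j)))) then vio M f j (fun i => w i.castSucc) a
    else if Nat.size a ≤ Nat.size (rho M f j (fun i => w i.castSucc)) then 1
    else vio M f j (fun i => w i.castSucc) a

lemma rho_bff {n : ℕ} {M : (Fin n → ℕ) → ℕ} (hM : BFF 1 n (fun _ u => M u)) (j : ℕ) :
    BFF 1 (n + j) (fun f w => rho M f j w) := by
  induction j with
  | zero => exact hM
  | succ j ih =>
    have h1 : BFF 1 (n + j + 1) (fun f w => rho M f j (fun i => w i.castSucc)) :=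
      BFF.subst ih (BV.vars _)
    have h2 := BFF.smash' h1 (BFF.dbl1 (BFF.app (BFF.var (Fin.last (n + j)))))
    exact BFF.smash' h2 h2

lemma vio_bff {n : ℕ} {M : (Fin n → ℕ) → ℕ} (hM : BFF 1 n (fun _ u => M u)) (j : ℕ) :
    BFF 1 (n + j + 1) (fun f u => vio M f j (fun i => u i.castSucc) (u (Fin.last (n + j)))) := by
  induction j with
  | zero => exact BFF.zero' (by omega)
  | succ j ih =>
    have h1 : BFF 1 (n + j + 2) (fun f u => vio M f j (fun i => u i.castSucc.castSucc)
        (u (Fin.last (n + j + 1)))) := BFF.subW ih (BV.vars _) (BFF.var _)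
    have h2 : BFF 1 (n + j + 2) (fun f u => rho M f j (fun i => u i.castSucc.castSucc)) :=
      BFF.subst (rho_bff hM j) (BV.vars _)
    have h3 : BFF 1 (n + j + 2) (fun f u => 1) := by
      simpa using BFF.dbl1 (BFF.zero' (k := 1) (m := n + j + 2) (by omega))
    exact BFF.szle (BFF.app (BFF.var _)) (BFF.app (BFF.var (Fin.last (n + j)).castSucc)) h1
      (BFF.szle (BFF.var _) h2 h3 h1)

lemma rho_bound {n : ℕ} (M : (Fin n → ℕ) → ℕ) (f : Fin 1 → ℕ → ℕ) (g : ℕ → ℕ) (j : ℕ)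
    (w : Fin (n + j) → ℕ) (hg : ∀ a, g a = 0 ∨ (g a = f 0 a ∧ vio M f j w a = 0)) :
    Rseq g (Nat.size (M (lft w))) j ≤ Nat.size (rho M f j w) := by
  induction j with
  | zero => exact le_rfl
  | succ j ih =>
    have h1 := ih (fun i => w i.castSucc) (fun a => by
      rcases hg a with h | ⟨h, h'⟩
      · exact Or.inl h
      · refine Or.inr ⟨h, ?_⟩
        simp only [vio] at h'
        split_ifs at h' <;> assumption)
    have h2 : fnorm g (Nat.size (rho M f j (fun i => w i.castSucc))) ≤
        Nat.size (f 0 (w (Fin.last (n + j)))) := by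
      unfold fnorm
      apply Finset.sup_le
      intro a ha
      rw [Finset.mem_range, ← Nat.size_le] at ha
      rcases hg a with h | ⟨h, h'⟩
      · simp [h]
      · rw [h]
        simp only [vio] at h'
        split_ifs at h' with h3
        exact h3
    have h3 := stp_mono h1 ((fnorm_mono g h1).trans h2)
    simp only [rho, size_smash, size_dbl1]
    exact h3

lemma level_down {n : ℕ} (hn : 0 < n) {M : (Fin n → ℕ) → ℕ} (hM : BFF 1 n (fun _ u => M u))
    {F : (Fin 1 → ℕ → ℕ) → (Fin n → ℕ) → ℕ} (j : ℕ)
    (h : ∃ Val Vio, BFF 1 (n + (j + 1)) Val ∧ BFF 1 (n + (j + 1)) Vio ∧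
      ∀ f w, vio M f (j + 1) w (Vio f w) = 0 → Val f w = F f (lft w)) :
    ∃ Val Vio, BFF 1 (n + j) Val ∧ BFF 1 (n + j) Vio ∧
      ∀ f w, vio M f j w (Vio f w) = 0 → Val f w = F f (lft w) := by
  obtain ⟨Val, Vio, hVal, hVio, h⟩ := h
  have hVio' : BFF 1 (n + j + 1) Vio := hVio
  have hS : BFF 1 (n + j + 1) (fun f u =>
      if Nat.size (f 0 (Vio f u)) ≤ Nat.size (f 0 (u (Fin.last (n + j)))) then u (Fin.last (n + j))
      else if Nat.size (Vio f u) ≤ Nat.size (rho M f j (fun i => u i.castSucc)) then Vio f u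
      else u (Fin.last (n + j))) :=
    BFF.szle (BFF.app hVio') (BFF.app (BFF.var _)) (BFF.var _)
      (BFF.szle hVio' (BFF.subst (rho_bff hM j) (BV.vars _)) hVio' (BFF.var _))
  obtain ⟨B, hB, hB'⟩ := fixpoint (by omega) hS (rho_bff hM j) (by
    intro f w b
    simp only [sn, Fin.snoc_last, Fin.snoc_castSucc]
    split_ifs with h1 h2
    · exact Or.inl rfl
    · exact Or.inr ⟨h2, by omega⟩
    · exact Or.inl rfl)
  refine ⟨_, _, BFF.subst hVal (BV.snoc (n := n + j) BV.id hB),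
    BFF.subst hVio (BV.snoc (n := n + j) BV.id hB), fun f w hw => ?_⟩
  have h1 := hB' f w
  have e := lft_sn w (B f w)
  rw [h f (sn (n := n + j) w (B f w)) ?_, e]
  simp only [vio]
  simp only [sn, Fin.snoc_last, Fin.snoc_castSucc] at h1 hw ⊢
  split_ifs with h2 h3
  · exact hw
  · rw [if_neg h2, if_pos h3] at h1
    rw [h1] at h2
    exact absurd le_rfl h2
  · exact hw

lemma trunc_spec (V f : ℕ → ℕ) (a : ℕ) : trunc V f a = 0 ∨ (trunc V f a = f a ∧ V a = 0) := by
  unfold trunc; split_ifs with h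
  · exact Or.inr ⟨rfl, h⟩
  · exact Or.inl rfl

lemma level_top (l : ℕ)
    (G : (Fin 1 → ℕ → ℕ) → (Fin l → ℕ) → ℕ)
    (H : (Fin 1 → ℕ → ℕ) → (Fin (l + 2) → ℕ) → ℕ)
    (F : (Fin 1 → ℕ → ℕ) → (Fin (l + 1) → ℕ) → ℕ)
    (hG : BFF 1 l G) (hH : BFF 1 (l + 2) H)
    (hbase : ∀ f x, F f (sn x 0) = G f x)
    (hrec : ∀ f x y, 0 < y → F f (sn x y) = H f (sn (sn x (F f (sn x (y / 2)))) y))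
    (M : (Fin (l + 1) → ℕ) → ℕ) (hM : BFF 1 (l + 1) (fun _ u => M u)) (d : ℕ)
    (hbd : ∀ f x y y', Nat.size y' ≤ Nat.size y →
      Nat.size (F f (sn x y')) ≤ Rseq (f 0) (Nat.size (M (sn x y))) d) :
    ∃ Val Vio, BFF 1 (l + 1 + d) Val ∧ BFF 1 (l + 1 + d) Vio ∧
      ∀ f w, vio M f d w (Vio f w) = 0 → Val f w = F f (lft w) := by
  have hV := vio_bff hM d
  have hρ := rho_bff hM d
  have hT : BFF 1 (l + 1 + d + 1) (fun f u =>
      trunc (fun a => vio M f d (fun i => u i.castSucc) a) (f 0) (u (Fin.last (l + 1 + d)))) :=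
    BFF.cond hV (BFF.app (BFF.var _)) (BFF.zero' (by omega))
  have hsub : ∀ {l' : ℕ} {G : (Fin 1 → ℕ → ℕ) → (Fin l' → ℕ) → ℕ}, BFF 1 l' G →
      BFF 1 (l + 1 + d + l') (fun f v => G (fun _ => trunc (vio M f d (lft v)) (f 0)) (rgt v)) := by
    intro l' G hG
    have := hG.substFun hT
    simp only [sn, Fin.snoc_last, Fin.snoc_castSucc] at this
    exact this
  have hfind : ∀ {l' : ℕ} {G : (Fin 1 → ℕ → ℕ) → (Fin l' → ℕ) → ℕ}, BFF 1 l' G →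
      ∃ D, BFF 1 (l + 1 + d + l') D ∧ ∀ f v, vio M f d (lft v) (D f v) = 0 →
      G f (rgt v) = G (fun _ => trunc (vio M f d (lft v)) (f 0)) (rgt v) := by
    intro l' G hG
    obtain ⟨D, hD, h⟩ := finder hG (by omega) hV
    refine ⟨D, hD, fun f v hv => ?_⟩
    have := h f v (by simpa only [sn, Fin.snoc_last, Fin.snoc_castSucc] using hv)
    simp only [sn, Fin.snoc_last, Fin.snoc_castSucc] at this
    rw [show (fun _ : Fin 1 => f 0) = f from funext fun i => by rw [Subsingleton.elim i 0]] at this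
    exact this
  clear hT
  -- truncated recursion
  have hK : BFF 1 (l + 1 + d + l) (fun f v => rho M f d (lft v)) := BFF.subst hρ BV.lft
  have hK' : BFF 1 (l + 1 + d + l + 1) (fun f v => rho M f d (lft (l := l + 1) v)) :=
    BFF.subst hρ (BV.lft (l := l + 1))
  obtain ⟨Φ, hΦ, hΦ0, hΦ1⟩ := brec (BFF.tr' (by omega) hK (hsub hG)) (hsub hH) hK' (by
    intro f x; rw [lft_sn]; exact size_tr _ _)
  obtain ⟨DG, hDG, hDG'⟩ := hfind hG
  obtain ⟨DH, hDH, hDH'⟩ := hfind hH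
  have hX : BV 1 (l + 1 + d + l + 1) (l + 1 + d + l + 1) (fun _ u =>
      sn (fun i : Fin (l + 1 + d + l) => u i.castSucc) (u (Fin.last (l + 1 + d + l)) / 2)) :=
    BV.snoc (BV.vars _) (BFF.half (BFF.var _))
  have hE : BFF 1 (l + 1 + d + l + 1) (fun f u => DH f (sn (n := l + 1 + d + l + 1)
      (sn (n := l + 1 + d + l) (fun i : Fin (l + 1 + d + l) => u i.castSucc)
        (Φ f (sn (fun i : Fin (l + 1 + d + l) => u i.castSucc) (u (Fin.last (l + 1 + d + l)) / 2))))
      (u (Fin.last (l + 1 + d + l))))) :=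
    BFF.subst hDH (BV.snoc (BV.snoc (BV.vars _) (BFF.subst hΦ hX)) (BFF.var _))
  have hW : BFF 1 (l + 1 + d + l + 1) (fun f u => (fun f (v : Fin (l + 1 + d + l) → ℕ) a =>
      vio M f d (lft v) a) f (fun i => u i.castSucc) (u (Fin.last (l + 1 + d + l)))) :=
    BFF.subW hV (BV.vars _) (BFF.var _)
  obtain ⟨J, hJ, hJ'⟩ := joinRec (W := fun f v a => vio M f d (lft v) a) (by omega) hW hDG hE
  have hin : BV 1 (l + 1 + d) (l + 1 + d + l + 1) (fun _ w =>
      sn (Fin.append w (fun i : Fin l => lft w i.castSucc)) (lft w (Fin.last l))) :=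
    BV.snoc (BV.append BV.id (BV.vars (fun i : Fin l => Fin.castAdd d i.castSucc))) (BFF.var _)
  refine ⟨_, _, BFF.subst hΦ hin, BFF.subst hJ hin, fun f w hw => ?_⟩
  obtain ⟨x, y, hxy⟩ : ∃ x y, lft w = sn (n := l) x y := ⟨_, _, (sn_eta (lft w)).symm⟩
  have hx : (fun i : Fin l => lft w i.castSucc) = x := by funext i; rw [hxy]; simp [sn]
  have hy : lft w (Fin.last l) = y := by rw [hxy]; simp [sn]
  rw [hx, hy] at hw ⊢
  rw [hxy]
  generalize hv : Fin.append w x = v at hw ⊢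
  have lv : lft v = w := by rw [← hv, lft_append]
  have rv : rgt v = x := by rw [← hv, rgt_append]
  obtain ⟨j0, j1⟩ := hJ' f v y (by rw [lv]; exact hw)
  obtain ⟨g, hg⟩ : ∃ g, g = trunc (vio M f d w) (f 0) := ⟨_, rfl⟩
  have hR : Rseq g (Nat.size (M (sn x y))) d ≤ Nat.size (rho M f d w) := by
    rw [← hxy]
    exact rho_bound M f g d w (fun a => by rw [hg]; exact trunc_spec _ _ a)
  have hsz : ∀ y', Nat.size y' ≤ Nat.size y →
      Nat.size (F (fun _ => g) (sn x y')) ≤ Nat.size (rho M f d w) :=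
    fun y' h => (hbd (fun _ => g) x y y' h).trans hR
  have e1 := fun a => lft_sn v a
  have e2 := fun a => rgt_sn v a
  have e3 := fun x a => lft_sn (p := l + 1 + d) (l := l + 1) x a
  have e4 := fun x a => rgt_sn (p := l + 1 + d) (l := l + 1) x a
  have hΦF : ∀ y', Nat.size y' ≤ Nat.size y → Φ f (sn v y') = F (fun _ => g) (sn x y') := by
    intro y'
    induction y' using Nat.strong_induction_on with
    | _ y' ih =>
      intro hle
      have hs := hsz y' hle
      rcases Nat.eq_zero_or_pos y' with rfl | hy'
      · rw [hΦ0, lv, rv, ← hg, ← hbase, tr_eq hs]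
      · have hle2 : Nat.size (y' / 2) ≤ Nat.size y :=
          (Nat.size_le_size (Nat.div_le_self _ _)).trans hle
        rw [hΦ1 f v y' hy', ih (y' / 2) (by omega) hle2]
        simp only [e1, e2, e3, e4, lv, rv]
        rw [← hg, ← hrec _ _ _ hy', tr_eq hs]
  simp only [sn, Fin.snoc_castSucc, Fin.snoc_last] at j1
  rw [hΦF y le_rfl]
  symm
  refine (rec_induct (P := fun y' => Nat.size y' ≤ Nat.size y → F f (sn x y') = F (fun _ => g) (sn x y'))
    (ok := fun y' => vio M f d (lft v) (DH f (sn (n := l + 1 + d + l + 1)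
      (sn (n := l + 1 + d + l) v (Φ f (sn v (y' / 2)))) y')) = 0) ?_ ?_ y j1) le_rfl
  · intro _
    have := hDG' f v j0
    rw [lv, rv, ← hg] at this
    rw [hbase, hbase, this]
  · intro y' hy' hok hP hle
    have hle2 : Nat.size (y' / 2) ≤ Nat.size y :=
      (Nat.size_le_size (Nat.div_le_self _ _)).trans hle
    rw [hΦF _ hle2] at hok
    have m1 := hDH' f (sn (n := l + 1 + d + l + 1)
      (sn (n := l + 1 + d + l) v (F (fun _ => g) (sn x (y' / 2)))) y') (by
        rw [e3, e1]; exact hok)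
    simp only [e1, e2, e3, e4, lv, rv] at m1
    rw [← hg] at m1
    rw [hrec _ _ _ hy', hrec _ _ _ hy', hP hle2, m1]

/-- If `F(f,x⃗,y)` is defined from basic feasible functionals `G(f,x⃗)` and `H(f,x⃗,z,y)` by
polynomially bounded recursion on notation with a second-order polynomial bound `Q`, i.e.
`F(f,x⃗,0) = G(f,x⃗)`, `F(f,x⃗,y) = H(f,x⃗,F(f,x⃗,⌊y/2⌋),y)` for `y > 0`, and
`|F(f,x⃗,y)| ≤ Q(|f|,|x⃗|,|y|)`, then `F` is a basic feasible functional. -/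
theorem bff_of_polynomially_bounded_recursion_on_notation (l : ℕ)
    (G : (Fin 1 → ℕ → ℕ) → (Fin l → ℕ) → ℕ)
    (H : (Fin 1 → ℕ → ℕ) → (Fin (l + 2) → ℕ) → ℕ)
    (F : (Fin 1 → ℕ → ℕ) → (Fin (l + 1) → ℕ) → ℕ)
    (Q : SOPoly 1 (l + 1))
    (hG : BFF 1 l G) (hH : BFF 1 (l + 2) H)
    (hbase : ∀ f x, F f (Fin.snoc x 0) = G f x)
    (hrec : ∀ f x y, 0 < y → F f (Fin.snoc x y) =
      H f (Fin.snoc (Fin.snoc x (F f (Fin.snoc x (y / 2)))) y))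
    (hbound : ∀ f x y, Nat.size (F f (Fin.snoc x y)) ≤ Q.eval f (Fin.snoc x y)) :
    BFF 1 (l + 1) F := by
  obtain ⟨d, hd⟩ := poly_bound Q
  obtain ⟨M, hM, hM'⟩ := exists_max l
  have htop := level_top l G H F hG hH hbase hrec M hM d (by
    intro f x y y' h
    refine (hbound f x y').trans (hd f _ _ (hM' _).1 ?_)
    intro i
    refine Fin.lastCases ?_ (fun j => ?_) i
    · have := (hM' (sn x y)).2 (Fin.last l)
      simp only [sn, Fin.snoc_last] at this ⊢
      exact h.trans this
    · have := (hM' (sn x y)).2 j.castSucc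
      simp only [sn, Fin.snoc_castSucc] at this ⊢
      exact this)
  have hall : ∀ e, e ≤ d → ∃ Val Vio, BFF 1 (l + 1 + (d - e)) Val ∧ BFF 1 (l + 1 + (d - e)) Vio ∧
      ∀ f w, vio M f (d - e) w (Vio f w) = 0 → Val f w = F f (lft w) := by
    intro e
    induction e with
    | zero => intro _; exact htop
    | succ e ih =>
      intro he
      have := ih (by omega)
      obtain ⟨j, hj⟩ : ∃ j, d - e = j + 1 := ⟨d - e - 1, by omega⟩
      rw [hj] at this
      rw [show d - (e + 1) = j by omega]
      exact level_down (by omega) hM j this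
  have h0 := hall d le_rfl
  rw [Nat.sub_self] at h0
  obtain ⟨Val, Vio, hVal, -, h⟩ := h0
  refine (congrArg (BFF 1 (l + 1)) ?_).mp hVal
  funext f w
  exact h f w rfl
end
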